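/- arXiv:2005.10617 — 11 statements merged into one kernel-verified Lean document; each statement's English description precedes it below -/
import Mathlib

section
/- Let α, β ∈ ℤⁿ. Then Λ(Ẽα, B̃β) = −⟨β, α⟩, where Λ(x,y) = xᵀΛy. (Lemma 5.2(1): first compatibility identity between the skew form Λ and the Euler form.) -/
open Matrix

/-- Lemma 5.2(1): Λ(Ẽα, B̃β) = −⟨β, α⟩ for a compatible pair. -/
theorem stmt_0 (n m : ℕ) (hn : 0 < n) (hnm : n ≤ m)
    (d : Fin n → ℤ) (hd : ∀ i, 0 < d i)
    (R R' : Matrix (Fin n) (Fin n) ℤ)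
    (hDR : diagonal d * R' = Rᵀ * diagonal d)
    (Rt Rt' : Matrix (Fin m) (Fin n) ℤ)
    (hRt : ∀ (i j : Fin n), Rt (Fin.castLE hnm i) j = R i j)
    (hRt' : ∀ (i j : Fin n), Rt' (Fin.castLE hnm i) j = R' i j)
    (It Bt Et Et' : Matrix (Fin m) (Fin n) ℤ)
    (hIt : ∀ (i : Fin m) (j : Fin n), It i j = if (i : ℕ) = (j : ℕ) then 1 else 0)
    (hBt : Bt = Rt' - Rt) (hEt : Et = It - Rt') (hEt' : Et' = It - Rt)
    (Λ : Matrix (Fin m) (Fin m) ℤ) (hΛ : Λᵀ = -Λ)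
    (hcompat : Λ * (-Bt) = Matrix.of (fun (i : Fin m) (j : Fin n) =>
      if h : (i : ℕ) < n then diagonal d ⟨i, h⟩ j else 0))
    (α β : Fin n → ℤ) :
    (Et *ᵥ α) ⬝ᵥ (Λ *ᵥ (Bt *ᵥ β)) =
      -(β ⬝ᵥ ((diagonal d * (1 - R')) *ᵥ α)) := by
  have hIt2 : ∀ (i : Fin m) (j : Fin n), It i j = if i = Fin.castLE hnm j then 1 else 0 := by
    intro i j
    rw [hIt]
    simp [Fin.ext_iff]
  have hC : Λ * Bt = -(It * diagonal d) := by
    have h1 : Λ * Bt = -(Λ * (-Bt)) := by simp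
    rw [h1, hcompat]
    congr 1
    ext i j
    rw [Matrix.mul_diagonal, hIt, Matrix.of_apply]
    by_cases h : (i : ℕ) < n
    · simp only [h, dif_pos, Matrix.diagonal_apply, Fin.ext_iff]
      by_cases h2 : (i : ℕ) = j
      · have : (⟨i, h⟩ : Fin n) = j := Fin.ext h2
        simp [this, h2]
      · simp [h2]
    · have h2 : (i : ℕ) ≠ j := by have := j.2; omega
      simp [h, h2]
  have hE : Itᵀ * Et = 1 - R' := by
    ext i j
    rw [Matrix.mul_apply]
    simp only [Matrix.transpose_apply, hIt2, ite_mul, one_mul, zero_mul, Finset.sum_ite_eq',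
      Finset.sum_ite_eq, Finset.mem_univ, if_true, hEt, Matrix.sub_apply, hRt', Matrix.one_apply]
    congr 1
    simp
  rw [Matrix.mulVec_mulVec, hC, Matrix.neg_mulVec, dotProduct_neg, ← Matrix.mulVec_mulVec,
    Matrix.dotProduct_mulVec, ← Matrix.mulVec_transpose, Matrix.mulVec_mulVec, hE,
    Matrix.dotProduct_mulVec, ← Matrix.mulVec_transpose, Matrix.diagonal_transpose,
    Matrix.mulVec_mulVec, dotProduct_comm]
end

section
/- Let α, β ∈ ℤⁿ. Then Λ(B̃α, B̃β) = ⟨β, α⟩ − ⟨α, β⟩, where Λ(x,y) = xᵀΛy. (Lemma 5.2(2): the skew form Λ restricted to the column space of B̃ computes the antisymmetrized Euler form.) -/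
open Matrix

/-- Lemma 5.2(2): Λ(B̃α, B̃β) = ⟨β, α⟩ − ⟨α, β⟩ for a compatible pair. -/
theorem stmt_1 (n m : ℕ) (hn : 0 < n) (hnm : n ≤ m)
    (d : Fin n → ℤ) (hd : ∀ i, 0 < d i)
    (R R' : Matrix (Fin n) (Fin n) ℤ)
    (hDR : diagonal d * R' = Rᵀ * diagonal d)
    (Rt Rt' : Matrix (Fin m) (Fin n) ℤ)
    (hRt : ∀ (i j : Fin n), Rt (Fin.castLE hnm i) j = R i j)
    (hRt' : ∀ (i j : Fin n), Rt' (Fin.castLE hnm i) j = R' i j)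
    (It Bt Et Et' : Matrix (Fin m) (Fin n) ℤ)
    (hIt : ∀ (i : Fin m) (j : Fin n), It i j = if (i : ℕ) = (j : ℕ) then 1 else 0)
    (hBt : Bt = Rt' - Rt) (hEt : Et = It - Rt') (hEt' : Et' = It - Rt)
    (Λ : Matrix (Fin m) (Fin m) ℤ) (hΛ : Λᵀ = -Λ)
    (hcompat : Λ * (-Bt) = Matrix.of (fun (i : Fin m) (j : Fin n) =>
      if h : (i : ℕ) < n then diagonal d ⟨i, h⟩ j else 0))
    (α β : Fin n → ℤ) :
    (Bt *ᵥ α) ⬝ᵥ (Λ *ᵥ (Bt *ᵥ β)) =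
      β ⬝ᵥ ((diagonal d * (1 - R')) *ᵥ α) - α ⬝ᵥ ((diagonal d * (1 - R')) *ᵥ β) := by
  have key : Btᵀ * (Λ * Bt) = diagonal d * R' - R'ᵀ * diagonal d := by
    have h1 : Λ * Bt = -(Λ * (-Bt)) := by rw [Matrix.mul_neg, neg_neg]
    rw [h1, hcompat, hDR]
    ext k j
    rw [Matrix.mul_neg, Matrix.neg_apply, Matrix.mul_apply,
      Finset.sum_eq_single (Fin.castLE hnm j)]
    · simp [hBt, hRt, hRt', Matrix.mul_diagonal]
      ring
    · intro i _ hi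
      by_cases h : (i : ℕ) < n
      · have hne : (⟨i, h⟩ : Fin n) ≠ j := by
          rintro rfl
          exact hi (by ext; simp)
        simp [h, Matrix.diagonal_apply_ne _ hne]
      · simp [h]
    · simp
  have hT : (diagonal d * (1 - R'))ᵀ = diagonal d - R'ᵀ * diagonal d := by
    simp [Matrix.mul_sub, Matrix.transpose_mul]
  have e1 : (Bt *ᵥ α) ⬝ᵥ (Λ *ᵥ (Bt *ᵥ β)) = α ⬝ᵥ ((Btᵀ * (Λ * Bt)) *ᵥ β) := by
    rw [← Matrix.mulVec_mulVec, ← Matrix.mulVec_mulVec, Matrix.dotProduct_mulVec α,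
      Matrix.vecMul_transpose]
  have e2 : β ⬝ᵥ ((diagonal d * (1 - R')) *ᵥ α) = α ⬝ᵥ ((diagonal d * (1 - R'))ᵀ *ᵥ β) := by
    rw [Matrix.dotProduct_mulVec, Matrix.mulVec_transpose, dotProduct_comm]
  rw [e1, e2, key, hT, ← dotProduct_sub, ← Matrix.sub_mulVec]
  congr 2
  rw [Matrix.mul_sub, Matrix.mul_one]
  abel
end

section
/- For all α, β ∈ ℤⁿ one has Λ(Ẽ'α, Ẽ'β) = Λ(Ẽα, Ẽβ), where Λ(x,y) = xᵀΛy. (Lemma 5.3(1).) -/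
open Matrix

/-- Lemma 5.3(1): Λ(Ẽ'α, Ẽ'β) = Λ(Ẽα, Ẽβ). -/
theorem stmt_2 (n m : ℕ) (hn : 0 < n) (hnm : n ≤ m)
    (d : Fin n → ℤ) (hd : ∀ i, 0 < d i)
    (R R' : Matrix (Fin n) (Fin n) ℤ)
    (hDR : diagonal d * R' = Rᵀ * diagonal d)
    (Rt Rt' : Matrix (Fin m) (Fin n) ℤ)
    (hRt : ∀ (i j : Fin n), Rt (Fin.castLE hnm i) j = R i j)
    (hRt' : ∀ (i j : Fin n), Rt' (Fin.castLE hnm i) j = R' i j)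
    (It Bt Et Et' : Matrix (Fin m) (Fin n) ℤ)
    (hIt : ∀ (i : Fin m) (j : Fin n), It i j = if (i : ℕ) = (j : ℕ) then 1 else 0)
    (hBt : Bt = Rt' - Rt) (hEt : Et = It - Rt') (hEt' : Et' = It - Rt)
    (Λ : Matrix (Fin m) (Fin m) ℤ) (hΛ : Λᵀ = -Λ)
    (hcompat : Λ * (-Bt) = Matrix.of (fun (i : Fin m) (j : Fin n) =>
      if h : (i : ℕ) < n then diagonal d ⟨i, h⟩ j else 0))
    (α β : Fin n → ℤ) :
    (Et' *ᵥ α) ⬝ᵥ (Λ *ᵥ (Et' *ᵥ β)) = (Et *ᵥ α) ⬝ᵥ (Λ *ᵥ (Et *ᵥ β)) := by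
  have hT : ∀ (X : Matrix (Fin m) (Fin n) ℤ) (i j : Fin n),
      (Itᵀ * X) i j = X (Fin.castLE hnm i) j := by
    intro X i j
    rw [Matrix.mul_apply, Finset.sum_eq_single (Fin.castLE hnm i)]
    · simp [hIt]
    · intro k _ hk
      have : (k : ℕ) ≠ (i : ℕ) := fun h => hk (Fin.ext (by simpa using h))
      simp [hIt, this]
    · simp
  have h1 : Itᵀ * It = 1 := by
    ext i j
    rw [hT, hIt, Matrix.one_apply]
    simp [Fin.ext_iff]
  have h2 : Itᵀ * Rt = R := by
    ext i j
    rw [hT, hRt]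
  have h3 : Itᵀ * Rt' = R' := by
    ext i j
    rw [hT, hRt']
  have hJ : Λ * Bt = -(It * diagonal d) := by
    have : Λ * (-Bt) = It * diagonal d := by
      rw [hcompat]
      ext i j
      rw [Matrix.mul_diagonal, hIt]
      by_cases h : (i : ℕ) < n
      · by_cases hij : (i : ℕ) = (j : ℕ)
        · have : (⟨i, h⟩ : Fin n) = j := Fin.ext hij
          simp [this, hij]
        · have : (⟨i, h⟩ : Fin n) ≠ j := fun e => hij (congrArg Fin.val e)
          simp [this, hij]
      · have hij : (i : ℕ) ≠ (j : ℕ) := by have := j.2; omega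
        simp [h, hij]
    rw [← this, Matrix.mul_neg, neg_neg]
  have hJ' : Btᵀ * Λ = diagonal d * Itᵀ := by
    have := congrArg Matrix.transpose hJ
    simpa [Matrix.transpose_mul, hΛ] using this
  have hD : R'ᵀ * diagonal d = diagonal d * R := by
    have := congrArg Matrix.transpose hDR
    simpa [Matrix.transpose_mul] using this
  have hE : Et' = Et + Bt := by rw [hEt', hEt, hBt]; abel
  have e1 : Etᵀ * (Λ * Bt) = -(diagonal d - R'ᵀ * diagonal d) := by
    have h4 : Etᵀ * It = 1 - R'ᵀ := by
      have : Itᵀ * Et = 1 - R' := by rw [hEt, Matrix.mul_sub, h1, h3]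
      have := congrArg Matrix.transpose this
      simpa [Matrix.transpose_mul] using this
    rw [hJ, Matrix.mul_neg, ← Matrix.mul_assoc, h4, Matrix.sub_mul, Matrix.one_mul]
  have e2 : Btᵀ * Λ * Et' = diagonal d - diagonal d * R := by
    rw [hJ', Matrix.mul_assoc, hEt', Matrix.mul_sub, h1, h2, Matrix.mul_sub, Matrix.mul_one]
  have key : Et'ᵀ * Λ * Et' = Etᵀ * Λ * Et := by
    have : Et'ᵀ * Λ * Et' = Etᵀ * Λ * Et + Etᵀ * (Λ * Bt) + Btᵀ * Λ * Et' := by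
      rw [hE]
      simp only [Matrix.transpose_add, Matrix.add_mul, Matrix.mul_add, Matrix.mul_assoc]
      abel
    rw [this, e1, e2, hD]
    abel
  have fin : ∀ X : Matrix (Fin m) (Fin n) ℤ,
      (X *ᵥ α) ⬝ᵥ (Λ *ᵥ (X *ᵥ β)) = α ⬝ᵥ ((Xᵀ * Λ * X) *ᵥ β) := by
    intro X
    rw [← Matrix.mulVec_mulVec, ← Matrix.mulVec_mulVec, Matrix.dotProduct_mulVec α,
      Matrix.vecMul_transpose]
  rw [fin, fin, key]
end

section
/- For all α₁, β₁, α₂, β₂ ∈ ℤⁿ one has Λ(Ẽα₁ + Ẽ'β₁, Ẽα₂ + Ẽ'β₂) = Λ(Ẽ(α₁+β₁), Ẽ(α₂+β₂)) − ⟨β₂, α₁⟩ + ⟨β₁, α₂⟩, where Λ(x,y) = xᵀΛy. (Lemma 5.3(2).) -/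
open Matrix

/-- Lemma 5.3(2). -/
theorem stmt_3 (n m : ℕ) (hn : 0 < n) (hnm : n ≤ m)
    (d : Fin n → ℤ) (hd : ∀ i, 0 < d i)
    (R R' : Matrix (Fin n) (Fin n) ℤ)
    (hDR : diagonal d * R' = Rᵀ * diagonal d)
    (Rt Rt' : Matrix (Fin m) (Fin n) ℤ)
    (hRt : ∀ (i j : Fin n), Rt (Fin.castLE hnm i) j = R i j)
    (hRt' : ∀ (i j : Fin n), Rt' (Fin.castLE hnm i) j = R' i j)
    (It Bt Et Et' : Matrix (Fin m) (Fin n) ℤ)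
    (hIt : ∀ (i : Fin m) (j : Fin n), It i j = if (i : ℕ) = (j : ℕ) then 1 else 0)
    (hBt : Bt = Rt' - Rt) (hEt : Et = It - Rt') (hEt' : Et' = It - Rt)
    (Λ : Matrix (Fin m) (Fin m) ℤ) (hΛ : Λᵀ = -Λ)
    (hcompat : Λ * (-Bt) = Matrix.of (fun (i : Fin m) (j : Fin n) =>
      if h : (i : ℕ) < n then diagonal d ⟨i, h⟩ j else 0))
    (α₁ β₁ α₂ β₂ : Fin n → ℤ) :
    (Et *ᵥ α₁ + Et' *ᵥ β₁) ⬝ᵥ (Λ *ᵥ (Et *ᵥ α₂ + Et' *ᵥ β₂)) =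
      (Et *ᵥ (α₁ + β₁)) ⬝ᵥ (Λ *ᵥ (Et *ᵥ (α₂ + β₂)))
        - β₂ ⬝ᵥ ((diagonal d * (1 - R')) *ᵥ α₁)
        + β₁ ⬝ᵥ ((diagonal d * (1 - R')) *ᵥ α₂) := by
  have hX : ∀ (X : Matrix (Fin m) (Fin n) ℤ) (Y : Matrix (Fin n) (Fin n) ℤ),
      (∀ i j, X (Fin.castLE hnm i) j = Y i j) → Xᵀ * It = Yᵀ := by
    intro X Y h
    ext i j
    rw [Matrix.mul_apply, Finset.sum_eq_single (Fin.castLE hnm j)]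
    · simp [hIt, h]
    · intro b _ hb
      have : (b : ℕ) ≠ (j : ℕ) := fun e => hb (Fin.ext (by simpa using e))
      simp [hIt, this]
    · simp
  have hJ : Λ * Bt = -(It * diagonal d) := by
    rw [← neg_inj, ← Matrix.mul_neg, hcompat, neg_neg]
    ext i j
    rw [Matrix.mul_diagonal, hIt]
    by_cases h : (i : ℕ) < n
    · by_cases e : (i : ℕ) = (j : ℕ)
      · have : (⟨i, h⟩ : Fin n) = j := Fin.ext e
        simp [this, e]
      · have : (⟨i, h⟩ : Fin n) ≠ j := fun e' => e (congrArg Fin.val e')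
        simp [h, this, e]
    · have e : (i : ℕ) ≠ (j : ℕ) := by have := j.2; omega
      simp [h, e]
  have hItT : ∀ i j : Fin n, It (Fin.castLE hnm i) j = (1 : Matrix (Fin n) (Fin n) ℤ) i j := by
    intro i j
    simp [hIt, Matrix.one_apply, Fin.ext_iff]
  have hDRt : R'ᵀ * diagonal d = diagonal d * R := by
    have := congrArg Matrix.transpose hDR
    simpa [Matrix.transpose_mul] using this
  have h1 : Etᵀ * Λ * Bt = -(diagonal d * (1 - R'))ᵀ := by
    rw [Matrix.mul_assoc, hJ, Matrix.mul_neg, ← Matrix.mul_assoc,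
      hX Et (1 - R') (by intro i j; simp [hEt, hItT, hRt'])]
    simp [Matrix.transpose_mul]
  have h2 : Btᵀ * Λ * Et = diagonal d * (1 - R') := by
    have := congrArg Matrix.transpose h1
    simp only [Matrix.transpose_mul, Matrix.transpose_neg, Matrix.transpose_transpose, hΛ] at this
    rw [Matrix.neg_mul, Matrix.mul_neg, neg_inj] at this
    rw [Matrix.mul_assoc, this]
  have h3 : Btᵀ * Λ * Bt = (diagonal d * (1 - R'))ᵀ - diagonal d * (1 - R') := by
    rw [Matrix.mul_assoc, hJ, Matrix.mul_neg, ← Matrix.mul_assoc,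
      hX Bt (R' - R) (by intro i j; simp [hBt, hRt, hRt'])]
    simp only [Matrix.transpose_mul, Matrix.transpose_sub, Matrix.diagonal_transpose,
      Matrix.transpose_one, Matrix.sub_mul, Matrix.mul_sub, Matrix.one_mul, Matrix.mul_one, hDR, hDRt, Matrix.transpose_transpose]
    abel
  have hE : Et' = Et + Bt := by rw [hEt', hEt, hBt]; abel
  have key : ∀ (A C : Matrix (Fin m) (Fin n) ℤ) (a c : Fin n → ℤ),
      (A *ᵥ a) ⬝ᵥ (Λ *ᵥ (C *ᵥ c)) = a ⬝ᵥ ((Aᵀ * Λ * C) *ᵥ c) := by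
    intro A C a c
    rw [← Matrix.mulVec_mulVec, ← Matrix.mulVec_mulVec, Matrix.dotProduct_mulVec a,
      Matrix.vecMul_transpose]
  have tr : ∀ (G : Matrix (Fin n) (Fin n) ℤ) (a c : Fin n → ℤ),
      a ⬝ᵥ (Gᵀ *ᵥ c) = c ⬝ᵥ (G *ᵥ a) := by
    intro G a c
    rw [Matrix.mulVec_transpose, dotProduct_comm, ← Matrix.dotProduct_mulVec]
  subst hE
  simp only [Matrix.add_mulVec, Matrix.mulVec_add, add_dotProduct, dotProduct_add, key, h1, h2, h3,
    Matrix.neg_mulVec, dotProduct_neg, Matrix.sub_mulVec, dotProduct_sub, tr]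
  ring
end

section
/- Assume m = 2n. For all α, β ∈ ℤⁿ one has Λ(Ẽ'α, β̃) = Λ(Ẽα, β̃) and Λ(α̃, Ẽ'β) = Λ(α̃, Ẽβ), where for γ ∈ ℤⁿ the vector γ̃ ∈ ℤ^{2n} has first n coordinates zero and last n coordinates equal to γ, and Λ(x,y) = xᵀΛy. (Lemma 6.4.) -/
open Matrix

/-- Lemma 6.4: Λ(Ẽ'α, β̃) = Λ(Ẽα, β̃) and Λ(α̃, Ẽ'β) = Λ(α̃, Ẽβ). -/
theorem stmt_4 (n : ℕ) (hn : 0 < n)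
    (d : Fin n → ℤ) (hd : ∀ i, 0 < d i)
    (R R' : Matrix (Fin n) (Fin n) ℤ)
    (hDR : diagonal d * R' = Rᵀ * diagonal d)
    (Rt Rt' : Matrix (Fin (n + n)) (Fin n) ℤ)
    (hRt : ∀ (i j : Fin n), Rt (Fin.castLE (Nat.le_add_right n n) i) j = R i j)
    (hRt' : ∀ (i j : Fin n), Rt' (Fin.castLE (Nat.le_add_right n n) i) j = R' i j)
    (It Bt Et Et' : Matrix (Fin (n + n)) (Fin n) ℤ)
    (hIt : ∀ (i : Fin (n + n)) (j : Fin n), It i j = if (i : ℕ) = (j : ℕ) then 1 else 0)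
    (hBt : Bt = Rt' - Rt) (hEt : Et = It - Rt') (hEt' : Et' = It - Rt)
    (Λ : Matrix (Fin (n + n)) (Fin (n + n)) ℤ) (hΛ : Λᵀ = -Λ)
    (hcompat : Λ * (-Bt) = Matrix.of (fun (i : Fin (n + n)) (j : Fin n) =>
      if h : (i : ℕ) < n then diagonal d ⟨i, h⟩ j else 0))
    (α β : Fin n → ℤ) :
    (Et' *ᵥ α) ⬝ᵥ (Λ *ᵥ Fin.append (0 : Fin n → ℤ) β)
        = (Et *ᵥ α) ⬝ᵥ (Λ *ᵥ Fin.append (0 : Fin n → ℤ) β) ∧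
      (Fin.append (0 : Fin n → ℤ) α) ⬝ᵥ (Λ *ᵥ (Et' *ᵥ β))
        = (Fin.append (0 : Fin n → ℤ) α) ⬝ᵥ (Λ *ᵥ (Et *ᵥ β)) := by
  have key : ∀ γ δ : Fin n → ℤ,
      (Fin.append (0 : Fin n → ℤ) γ) ⬝ᵥ (Λ *ᵥ (Bt *ᵥ δ)) = 0 := by
    intro γ δ
    have h1 : Λ *ᵥ (Bt *ᵥ δ) = -((Λ * (-Bt)) *ᵥ δ) := by
      rw [Matrix.mul_neg, Matrix.neg_mulVec, neg_neg, Matrix.mulVec_mulVec]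
    rw [h1, hcompat, dotProduct, Fin.sum_univ_add]
    simp [Matrix.mulVec, dotProduct]
  have skew : ∀ x y : Fin (n + n) → ℤ, x ⬝ᵥ (Λ *ᵥ y) = -(y ⬝ᵥ (Λ *ᵥ x)) := by
    intro x y
    rw [Matrix.dotProduct_mulVec, ← Matrix.mulVec_transpose, hΛ, Matrix.neg_mulVec,
      neg_dotProduct, dotProduct_comm]
  have hE : Et' = Et + Bt := by
    rw [hEt', hEt, hBt]; abel
  have second : ∀ γ δ : Fin n → ℤ,
      (Fin.append (0 : Fin n → ℤ) γ) ⬝ᵥ (Λ *ᵥ (Et' *ᵥ δ))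
        = (Fin.append (0 : Fin n → ℤ) γ) ⬝ᵥ (Λ *ᵥ (Et *ᵥ δ)) := by
    intro γ δ
    rw [hE, Matrix.add_mulVec, Matrix.mulVec_add, dotProduct_add, key, add_zero]
  refine ⟨?_, second α β⟩
  rw [skew, second, ← skew]
end

section
/- Assume m = 2n. For all α₁, β₁, γ₁, δ₁, α₂, β₂, γ₂, δ₂ ∈ ℤⁿ one has Λ(Ẽ'(α₁+β₁) − α̃₂ − β̃₂, Ẽ'(γ₁+δ₁) − γ̃₂ − δ̃₂) − Λ(−Ẽα₁ − Ẽ'β₁ + α̃₂ + β̃₂, −Ẽγ₁ − Ẽ'δ₁ + γ̃₂ + δ̃₂) = ⟨δ₁, α₁⟩ − ⟨β₁, γ₁⟩. (The key displayed identity in the proof of Proposition 6.5.) -/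
open Matrix

/-- The key displayed identity in the proof of Proposition 6.5. -/
theorem stmt_5 (n : ℕ) (hn : 0 < n)
    (d : Fin n → ℤ) (hd : ∀ i, 0 < d i)
    (R R' : Matrix (Fin n) (Fin n) ℤ)
    (hDR : diagonal d * R' = Rᵀ * diagonal d)
    (Rt Rt' : Matrix (Fin (n + n)) (Fin n) ℤ)
    (hRt : ∀ (i j : Fin n), Rt (Fin.castLE (Nat.le_add_right n n) i) j = R i j)
    (hRt' : ∀ (i j : Fin n), Rt' (Fin.castLE (Nat.le_add_right n n) i) j = R' i j)
    (It Bt Et Et' : Matrix (Fin (n + n)) (Fin n) ℤ)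
    (hIt : ∀ (i : Fin (n + n)) (j : Fin n), It i j = if (i : ℕ) = (j : ℕ) then 1 else 0)
    (hBt : Bt = Rt' - Rt) (hEt : Et = It - Rt') (hEt' : Et' = It - Rt)
    (Λ : Matrix (Fin (n + n)) (Fin (n + n)) ℤ) (hΛ : Λᵀ = -Λ)
    (hcompat : Λ * (-Bt) = Matrix.of (fun (i : Fin (n + n)) (j : Fin n) =>
      if h : (i : ℕ) < n then diagonal d ⟨i, h⟩ j else 0))
    (α₁ β₁ γ₁ δ₁ α₂ β₂ γ₂ δ₂ : Fin n → ℤ) :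
    (Et' *ᵥ (α₁ + β₁) - Fin.append (0 : Fin n → ℤ) α₂ - Fin.append (0 : Fin n → ℤ) β₂) ⬝ᵥ
        (Λ *ᵥ (Et' *ᵥ (γ₁ + δ₁) - Fin.append (0 : Fin n → ℤ) γ₂ - Fin.append (0 : Fin n → ℤ) δ₂))
      - (-(Et *ᵥ α₁) - Et' *ᵥ β₁ + Fin.append (0 : Fin n → ℤ) α₂ + Fin.append (0 : Fin n → ℤ) β₂) ⬝ᵥ
        (Λ *ᵥ (-(Et *ᵥ γ₁) - Et' *ᵥ δ₁ + Fin.append (0 : Fin n → ℤ) γ₂ + Fin.append (0 : Fin n → ℤ) δ₂))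
    = δ₁ ⬝ᵥ ((diagonal d * (1 - R')) *ᵥ α₁) - β₁ ⬝ᵥ ((diagonal d * (1 - R')) *ᵥ γ₁) := by
  have key : ∀ (w : Fin (n + n) → ℤ) (y : Fin n → ℤ),
      w ⬝ᵥ (Λ *ᵥ (Bt *ᵥ y)) = -((fun i => w (Fin.castAdd n i)) ⬝ᵥ (diagonal d *ᵥ y)) := by
    intro w y
    have h1 : Λ *ᵥ (Bt *ᵥ y) = -((Λ * (-Bt)) *ᵥ y) := by
      rw [Matrix.mul_neg, Matrix.neg_mulVec, neg_neg, Matrix.mulVec_mulVec]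
    rw [h1, hcompat, dotProduct_neg]
    congr 1
    simp only [dotProduct, Fin.sum_univ_add]
    have h2 : ∀ i : Fin n, ((Matrix.of (fun (i : Fin (n + n)) (j : Fin n) =>
      if h : (i : ℕ) < n then diagonal d ⟨i, h⟩ j else 0)) *ᵥ y) (Fin.natAdd n i) = 0 := by
      intro i
      simp [Matrix.mulVec, dotProduct]
    have h3 : ∀ i : Fin n, ((Matrix.of (fun (i : Fin (n + n)) (j : Fin n) =>
      if h : (i : ℕ) < n then diagonal d ⟨i, h⟩ j else 0)) *ᵥ y) (Fin.castAdd n i)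
        = (diagonal d *ᵥ y) i := by
      intro i
      simp only [Matrix.mulVec, dotProduct]
      simp
    simp only [h2, h3, mul_zero, Finset.sum_const_zero, add_zero]
  have skew : ∀ x y : Fin (n + n) → ℤ, x ⬝ᵥ (Λ *ᵥ y) = -(y ⬝ᵥ (Λ *ᵥ x)) := by
    intro x y
    rw [Matrix.dotProduct_mulVec, ← Matrix.mulVec_transpose, hΛ, Matrix.neg_mulVec,
      neg_dotProduct, dotProduct_comm]
  have topE : ∀ x : Fin n → ℤ, (fun i => (Et' *ᵥ x) (Fin.castAdd n i)) = (1 - R) *ᵥ x := by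
    intro x
    funext i
    simp only [Matrix.mulVec, dotProduct]
    refine Finset.sum_congr rfl fun j _ => ?_
    have := hRt i j
    rw [hEt', Matrix.sub_apply, Matrix.sub_apply, hIt, Matrix.one_apply]
    have h : Rt (Fin.castAdd n i) j = R i j := this
    rw [h]
    simp [Fin.ext_iff]
  have topB : ∀ x : Fin n → ℤ, (fun i => (Bt *ᵥ x) (Fin.castAdd n i)) = (R' - R) *ᵥ x := by
    intro x
    funext i
    simp only [Matrix.mulVec, dotProduct]
    refine Finset.sum_congr rfl fun j _ => ?_
    have h : Rt (Fin.castAdd n i) j = R i j := hRt i j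
    have h' : Rt' (Fin.castAdd n i) j = R' i j := hRt' i j
    rw [hBt, Matrix.sub_apply, Matrix.sub_apply, h, h']
  have eul : ∀ x y : Fin n → ℤ, ((1 - R) *ᵥ x) ⬝ᵥ (diagonal d *ᵥ y)
      = x ⬝ᵥ ((diagonal d * (1 - R')) *ᵥ y) := by
    intro x y
    have : diagonal d * (1 - R') = (1 - R)ᵀ * diagonal d := by
      rw [Matrix.mul_sub, hDR, Matrix.transpose_sub, Matrix.sub_mul]
      simp
    rw [this, ← Matrix.mulVec_mulVec, Matrix.dotProduct_mulVec x, Matrix.vecMul_transpose]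
  have topU : ∀ x a b : Fin n → ℤ, (fun i => (Et' *ᵥ x - Fin.append (0 : Fin n → ℤ) a
      - Fin.append (0 : Fin n → ℤ) b) (Fin.castAdd n i)) = (1 - R) *ᵥ x := by
    intro x a b
    rw [← topE]
    funext i
    simp
  have second : ∀ x y a b : Fin n → ℤ, -(Et *ᵥ x) - Et' *ᵥ y + Fin.append (0 : Fin n → ℤ) a
      + Fin.append (0 : Fin n → ℤ) b = Bt *ᵥ x - (Et' *ᵥ (x + y) - Fin.append (0 : Fin n → ℤ) a
      - Fin.append (0 : Fin n → ℤ) b) := by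
    intro x y a b
    have : Et = Et' - Bt := by rw [hEt, hEt', hBt]; abel
    rw [this, Matrix.sub_mulVec, Matrix.mulVec_add]
    abel
  rw [second, second]
  have k1 := key (Et' *ᵥ (α₁ + β₁) - Fin.append (0 : Fin n → ℤ) α₂ - Fin.append (0 : Fin n → ℤ) β₂) γ₁
  have k2 := key (Et' *ᵥ (γ₁ + δ₁) - Fin.append (0 : Fin n → ℤ) γ₂ - Fin.append (0 : Fin n → ℤ) δ₂) α₁
  have k3 := key (Bt *ᵥ α₁) γ₁
  rw [topU, eul, add_dotProduct] at k1 k2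
  rw [topB] at k3
  generalize Et' *ᵥ (α₁ + β₁) - Fin.append (0 : Fin n → ℤ) α₂ - Fin.append (0 : Fin n → ℤ) β₂ = u at *
  generalize Et' *ᵥ (γ₁ + δ₁) - Fin.append (0 : Fin n → ℤ) γ₂ - Fin.append (0 : Fin n → ℤ) δ₂ = v at *
  have k4 := skew (Bt *ᵥ α₁) v
  have e1 := eul α₁ γ₁
  have e2 : γ₁ ⬝ᵥ ((diagonal d * (1 - R')) *ᵥ α₁) = ((1 - R') *ᵥ α₁) ⬝ᵥ (diagonal d *ᵥ γ₁) := by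
    rw [← Matrix.mulVec_mulVec, Matrix.dotProduct_mulVec, dotProduct_comm,
      ← Matrix.mulVec_transpose, Matrix.diagonal_transpose]
  rw [Matrix.sub_mulVec, sub_dotProduct] at e1 e2 k3
  simp only [Matrix.mulVec_sub, sub_dotProduct, dotProduct_sub]
  linarith
end

section
/- Assume m = 2n. For all α₁, β₁, γ₁, δ₁, α₂, β₂, γ₂, δ₂ ∈ ℤⁿ the following exponent identity holds: Λ(Ẽ'(α₁+β₁) − α̃₂ − β̃₂, Ẽ'(γ₁+δ₁) − γ̃₂ − δ̃₂) + 2(β₁, γ₁) + 2⟨α₁, δ₁⟩ − (α₁+γ₁, β₁+δ₁) − ⟨α₁+γ₁, β₁+δ₁⟩ = −(α₁, β₁) − ⟨α₁, β₁⟩ − (γ₁, δ₁) − ⟨γ₁, δ₁⟩ + Λ(−Ẽα₁ − Ẽ'β₁ + α̃₂ + β̃₂, −Ẽγ₁ − Ẽ'δ₁ + γ̃₂ + δ̃₂). (This identity is the entire content of Proposition 6.5, asserting that the map μ(X^{(α₁,α₂)} ⊗ X^{(β₁,β₂)}) = v^{−(α₁,β₁)−⟨α₁,β₁⟩} X^{−Ẽα₁−Ẽ'β₁+α̃₂+β̃₂}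 is an algebra homomorphism from the twisted tensor square of the torus to the quantum torus T_Λ.) -/
open Matrix

/-- Proposition 6.5: the exponent identity showing that μ is an algebra homomorphism. -/
theorem stmt_6 (n : ℕ) (hn : 0 < n)
    (d : Fin n → ℤ) (hd : ∀ i, 0 < d i)
    (R R' : Matrix (Fin n) (Fin n) ℤ)
    (hDR : diagonal d * R' = Rᵀ * diagonal d)
    (Rt Rt' : Matrix (Fin (n + n)) (Fin n) ℤ)
    (hRt : ∀ (i j : Fin n), Rt (Fin.castLE (Nat.le_add_right n n) i) j = R i j)
    (hRt' : ∀ (i j : Fin n), Rt' (Fin.castLE (Nat.le_add_right n n) i) j = R' i j)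
    (It Bt Et Et' : Matrix (Fin (n + n)) (Fin n) ℤ)
    (hIt : ∀ (i : Fin (n + n)) (j : Fin n), It i j = if (i : ℕ) = (j : ℕ) then 1 else 0)
    (hBt : Bt = Rt' - Rt) (hEt : Et = It - Rt') (hEt' : Et' = It - Rt)
    (Λ : Matrix (Fin (n + n)) (Fin (n + n)) ℤ) (hΛ : Λᵀ = -Λ)
    (hcompat : Λ * (-Bt) = Matrix.of (fun (i : Fin (n + n)) (j : Fin n) =>
      if h : (i : ℕ) < n then diagonal d ⟨i, h⟩ j else 0))
    (L : (Fin (n + n) → ℤ) → (Fin (n + n) → ℤ) → ℤ)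
    (hL : ∀ x y, L x y = x ⬝ᵥ (Λ *ᵥ y))
    (e : (Fin n → ℤ) → (Fin n → ℤ) → ℤ)
    (he : ∀ x y, e x y = x ⬝ᵥ ((diagonal d * (1 - R')) *ᵥ y))
    (s : (Fin n → ℤ) → (Fin n → ℤ) → ℤ)
    (hs : ∀ x y, s x y = e x y + e y x)
    (tilde : (Fin n → ℤ) → (Fin (n + n) → ℤ))
    (htilde : ∀ x, tilde x = Fin.append (0 : Fin n → ℤ) x)
    (α₁ β₁ γ₁ δ₁ α₂ β₂ γ₂ δ₂ : Fin n → ℤ) :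
    L (Et' *ᵥ (α₁ + β₁) - tilde α₂ - tilde β₂) (Et' *ᵥ (γ₁ + δ₁) - tilde γ₂ - tilde δ₂)
        + 2 * s β₁ γ₁ + 2 * e α₁ δ₁ - s (α₁ + γ₁) (β₁ + δ₁) - e (α₁ + γ₁) (β₁ + δ₁)
      = -s α₁ β₁ - e α₁ β₁ - s γ₁ δ₁ - e γ₁ δ₁
        + L (-(Et *ᵥ α₁) - Et' *ᵥ β₁ + tilde α₂ + tilde β₂)
            (-(Et *ᵥ γ₁) - Et' *ᵥ δ₁ + tilde γ₂ + tilde δ₂) := by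
  have topE : ∀ x : Fin n → ℤ, (fun i => (Et' *ᵥ x) (Fin.castAdd n i)) = (1 - R) *ᵥ x := by
    intro x
    ext i
    simp only [mulVec, dotProduct]
    refine Finset.sum_congr rfl fun j _ => ?_
    have h := hRt i j
    have h2 : Fin.castLE (Nat.le_add_right n n) i = Fin.castAdd n i := rfl
    rw [h2] at h
    rw [hEt', Matrix.sub_apply, Matrix.sub_apply, h, hIt, Matrix.one_apply]
    simp [Fin.ext_iff]
  have topB : ∀ x : Fin n → ℤ, (fun i => (Bt *ᵥ x) (Fin.castAdd n i)) = (R' - R) *ᵥ x := by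
    intro x
    ext i
    simp only [mulVec, dotProduct]
    refine Finset.sum_congr rfl fun j _ => ?_
    have h := hRt i j
    have h' := hRt' i j
    have h2 : Fin.castLE (Nat.le_add_right n n) i = Fin.castAdd n i := rfl
    rw [h2] at h h'
    rw [hBt, Matrix.sub_apply, Matrix.sub_apply, h, h']
  have K : ∀ x y, L x (Bt *ᵥ y) = -((fun i => x (Fin.castAdd n i)) ⬝ᵥ (diagonal d *ᵥ y)) := by
    intro x y
    have h1 : Λ *ᵥ (Bt *ᵥ y) = -((Λ * (-Bt)) *ᵥ y) := by
      rw [mulVec_mulVec, Matrix.mul_neg, neg_mulVec, neg_neg]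
    rw [hL, h1, hcompat, dotProduct_neg]
    congr 1
    simp only [dotProduct, mulVec, Fin.sum_univ_add]
    simp
  have tr : ∀ (M : Matrix (Fin n) (Fin n) ℤ) (x y : Fin n → ℤ),
      (M *ᵥ x) ⬝ᵥ y = x ⬝ᵥ (Mᵀ *ᵥ y) := by
    intro M x y
    rw [dotProduct_mulVec, vecMul_transpose]
  have h1 : ∀ x y, L (Et' *ᵥ x) (Bt *ᵥ y) = - e x y := by
    intro x y
    rw [K, topE, he, tr, mulVec_mulVec, transpose_sub, transpose_one, Matrix.sub_mul, ← hDR,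
      Matrix.mul_sub, Matrix.one_mul, Matrix.mul_one]
  have h2 : ∀ x y, L (tilde x) (Bt *ᵥ y) = 0 := by
    intro x y
    rw [K, htilde]
    simp [dotProduct]
  have hDR' : R'ᵀ * diagonal d = diagonal d * R := by
    have := congrArg transpose hDR
    simpa [transpose_mul] using this.symm.symm
  have h3 : ∀ x y, L (Bt *ᵥ x) (Bt *ᵥ y) = e y x - e x y := by
    intro x y
    have h : e y x = x ⬝ᵥ ((diagonal d * (1 - R)) *ᵥ y) := by
      rw [he, dotProduct_comm, tr, transpose_mul, transpose_sub, transpose_one,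
        diagonal_transpose, Matrix.sub_mul, hDR', Matrix.mul_sub, Matrix.one_mul, Matrix.mul_one]
    rw [K, topB, h, he, tr, mulVec_mulVec, transpose_sub, Matrix.sub_mul, ← hDR, hDR',
      ← dotProduct_sub, ← sub_mulVec, ← dotProduct_neg, ← neg_mulVec]
    congr 2
    noncomm_ring
  have sk : ∀ x y, L x y = - L y x := by
    intro x y
    rw [hL, hL, dotProduct_mulVec, dotProduct_comm, ← mulVec_transpose, hΛ, neg_mulVec,
      dotProduct_neg]
  have la : ∀ x y z, L (x + y) z = L x z + L y z := by
    intro x y z; simp only [hL, add_dotProduct]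
  have ln : ∀ x z, L (-x) z = - L x z := by
    intro x z; simp only [hL, neg_dotProduct]
  have ra : ∀ x y z, L z (x + y) = L z x + L z y := by
    intro x y z; simp only [hL, mulVec_add, dotProduct_add]
  have rn : ∀ x z, L z (-x) = - L z x := by
    intro x z; simp only [hL, mulVec_neg, dotProduct_neg]
  have ea : ∀ x y z, e (x + y) z = e x z + e y z := by
    intro x y z; simp only [he, add_dotProduct]
  have ea' : ∀ x y z, e z (x + y) = e z x + e z y := by
    intro x y z; simp only [he, mulVec_add, dotProduct_add]
  have hE : ∀ x, Et *ᵥ x = Et' *ᵥ x + -(Bt *ᵥ x) := by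
    intro x
    rw [← sub_eq_add_neg, ← sub_mulVec, hEt, hEt', hBt]
    congr 1
    abel
  have h1' : ∀ x y, L (Bt *ᵥ y) (Et' *ᵥ x) = e x y := by
    intro x y; rw [sk, h1, neg_neg]
  have h2' : ∀ x y, L (Bt *ᵥ y) (tilde x) = 0 := by
    intro x y; rw [sk, h2, neg_zero]
  simp only [hE, hs, sub_eq_add_neg, mulVec_add, la, ln, ra, rn, ea, ea', h1, h2, h3, h1', h2']
  ring
end

section
/- Every object M_• = (f : M₋₁ → M₀) of C₂(𝒫) admits a direct sum decomposition M_• ≅ K_P ⊕ Z_Q ⊕ C_M in the arrow category, for some projective modules P, Q ∈ 𝒫 and some module M ∈ 𝒜, where C_M = (Ω_M → P_M) is given by a minimal projective resolution of M; moreover P, Q and M are uniquely determined up to isomorphism. (Lemma 2.4.) -/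
/-- A decomposition of an object `(f : M₁ → M₀)` of `C₂(𝒫)` as `K_P ⊕ Z_Q ⊕ C_M`,
where `K_P = (P →^id P)`, `Z_Q = (Q → 0)` and `C_M = (Ω_M →^δ P_M)` comes from a
minimal projective resolution `0 → Ω_M → P_M → M → 0` of a module `M`. -/
structure ArrowDecomp (A : Type) [Ring A]
    (M₁ M₀ : Type) [AddCommGroup M₁] [Module A M₁] [AddCommGroup M₀] [Module A M₀]
    (f : M₁ →ₗ[A] M₀) where
  P : Type
  Q : Type
  Ω : Type
  PM : Type
  M : Type
  [addP : AddCommGroup P]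
  [modP : Module A P]
  [addQ : AddCommGroup Q]
  [modQ : Module A Q]
  [addΩ : AddCommGroup Ω]
  [modΩ : Module A Ω]
  [addPM : AddCommGroup PM]
  [modPM : Module A PM]
  [addM : AddCommGroup M]
  [modM : Module A M]
  [finP : Module.Finite A P]
  [finQ : Module.Finite A Q]
  [finΩ : Module.Finite A Ω]
  [finPM : Module.Finite A PM]
  [finM : Module.Finite A M]
  projP : Module.Projective A P
  projQ : Module.Projective A Q
  projΩ : Module.Projective A Ω
  projPM : Module.Projective A PM
  /-- the monomorphism `δ : Ω_M → P_M` of the projective resolution -/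
  δ : Ω →ₗ[A] PM
  /-- the epimorphism `P_M → M` of the projective resolution -/
  π : PM →ₗ[A] M
  injδ : Function.Injective δ
  surjπ : Function.Surjective π
  exact : LinearMap.ker π = LinearMap.range δ
  /-- minimality: the image of `δ` is superfluous in `P_M`, i.e. `P_M → M` is a
  projective cover (equivalently `range δ ⊆ rad P_M`) -/
  minimal : ∀ N : Submodule A PM, N ⊔ LinearMap.range δ = ⊤ → N = ⊤
  /-- the isomorphism in degree `-1` -/
  e₁ : M₁ ≃ₗ[A] P × Q × Ω
  /-- the isomorphism in degree `0` -/
  e₀ : M₀ ≃ₗ[A] P × PM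
  /-- commutativity of the square: the pair `(e₁, e₀)` is an isomorphism in the arrow
  category from `f` to `K_P ⊕ Z_Q ⊕ C_M = ((p,q,ω) ↦ (p, δ ω))` -/
  comm : ∀ x : M₁, e₀ (f x) = ((e₁ x).1, δ (e₁ x).2.2)

attribute [instance] ArrowDecomp.addP ArrowDecomp.modP ArrowDecomp.addQ ArrowDecomp.modQ
  ArrowDecomp.addΩ ArrowDecomp.modΩ ArrowDecomp.addPM ArrowDecomp.modPM
  ArrowDecomp.addM ArrowDecomp.modM ArrowDecomp.finP ArrowDecomp.finQ
  ArrowDecomp.finΩ ArrowDecomp.finPM ArrowDecomp.finM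

theorem aux_phi_surj {A : Type} [Ring A] {M₁ M₀ : Type} [AddCommGroup M₁] [Module A M₁]
    [AddCommGroup M₀] [Module A M₀] {f : M₁ →ₗ[A] M₀} (D D' : ArrowDecomp A M₁ M₀ f) :
    Function.Surjective ((LinearMap.fst A D'.P D'.PM ∘ₗ D'.e₀.toLinearMap) ∘ₗ
      (D.e₀.symm.toLinearMap ∘ₗ LinearMap.inl A D.P D.PM)) := by
  set φ := ((LinearMap.fst A D'.P D'.PM ∘ₗ D'.e₀.toLinearMap) ∘ₗ
      (D.e₀.symm.toLinearMap ∘ₗ LinearMap.inl A D.P D.PM)) with hφ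
  set h := ((LinearMap.fst A D'.P D'.PM ∘ₗ D'.e₀.toLinearMap) ∘ₗ
      (D.e₀.symm.toLinearMap ∘ₗ LinearMap.inr A D.P D.PM)) with hh
  have key : ∀ p', ∃ p w, p' = φ p + h (D.δ w) := by
    intro p'
    let x := D'.e₁.symm (p', 0, 0)
    refine ⟨(D.e₁ x).1, (D.e₁ x).2.2, ?_⟩
    have h1 := D.comm x
    have h2 := D'.comm x
    have h3 : f x = D.e₀.symm ((D.e₁ x).1, 0) + D.e₀.symm (0, D.δ (D.e₁ x).2.2) := by
      rw [← map_add, LinearEquiv.eq_symm_apply, h1]; simp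
    have h4 : p' = (D'.e₀ (f x)).1 := by rw [h2]; simp [x]
    rw [h4, h3, map_add]
    simp [φ, h]
  have hs : Submodule.comap h (LinearMap.range φ) = ⊤ := by
    apply D.minimal
    rw [eq_top_iff]
    rintro x -
    obtain ⟨p, w, hp⟩ := key (h x)
    rw [Submodule.mem_sup]
    refine ⟨x - D.δ w, ⟨p, ?_⟩, D.δ w, ⟨w, rfl⟩, by simp⟩
    rw [map_sub, hp]; simp
  intro p'
  obtain ⟨p, w, hp⟩ := key p'
  have : D.δ w ∈ Submodule.comap h (LinearMap.range φ) := by rw [hs]; trivial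
  obtain ⟨p2, h2⟩ := this
  exact ⟨p + p2, by rw [map_add, h2, hp]⟩

theorem aux_P {A : Type} [Ring A] [IsNoetherianRing A] {M₁ M₀ : Type} [AddCommGroup M₁]
    [Module A M₁] [AddCommGroup M₀] [Module A M₀] {f : M₁ →ₗ[A] M₀}
    (D D' : ArrowDecomp A M₁ M₀ f) : Nonempty (D.P ≃ₗ[A] D'.P) := by
  have h1 := aux_phi_surj D D'
  have h2 := aux_phi_surj D' D
  set φ := ((LinearMap.fst A D'.P D'.PM ∘ₗ D'.e₀.toLinearMap) ∘ₗ
      (D.e₀.symm.toLinearMap ∘ₗ LinearMap.inl A D.P D.PM))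
  set ψ := ((LinearMap.fst A D.P D.PM ∘ₗ D.e₀.toLinearMap) ∘ₗ
      (D'.e₀.symm.toLinearMap ∘ₗ LinearMap.inl A D'.P D'.PM))
  have h3 : Function.Surjective (ψ ∘ₗ φ) := h2.comp h1
  have h4 : Function.Injective (ψ ∘ₗ φ) := IsNoetherian.injective_of_surjective_endomorphism _ h3
  have h5 : Function.Injective φ := Function.Injective.of_comp (f := ψ) h4
  exact ⟨LinearEquiv.ofBijective φ ⟨h5, h1⟩⟩

theorem aux_ker {A : Type} [Ring A] {M₁ M₀ : Type} [AddCommGroup M₁]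
    [Module A M₁] [AddCommGroup M₀] [Module A M₀] {f : M₁ →ₗ[A] M₀}
    (D : ArrowDecomp A M₁ M₀ f) (x : M₁) : f x = 0 ↔ ∃ q, x = D.e₁.symm (0, q, 0) := by
  constructor
  · intro h
    have h1 := D.comm x
    rw [h, map_zero] at h1
    have h2 : (D.e₁ x).1 = 0 := (congrArg Prod.fst h1).symm
    have h3 : D.δ (D.e₁ x).2.2 = 0 := (congrArg Prod.snd h1).symm
    have h4 : (D.e₁ x).2.2 = 0 := D.injδ (by rw [h3, map_zero])
    refine ⟨(D.e₁ x).2.1, ?_⟩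
    rw [LinearEquiv.eq_symm_apply]
    exact Prod.ext h2 (Prod.ext rfl h4)
  · rintro ⟨q, rfl⟩
    have h1 := D.comm (D.e₁.symm (0, q, 0))
    apply D.e₀.injective
    rw [h1]; simp

theorem aux_Q {A : Type} [Ring A] {M₁ M₀ : Type} [AddCommGroup M₁]
    [Module A M₁] [AddCommGroup M₀] [Module A M₀] {f : M₁ →ₗ[A] M₀}
    (D : ArrowDecomp A M₁ M₀ f) : Nonempty (D.Q ≃ₗ[A] LinearMap.ker f) := by
  let g : D.Q →ₗ[A] M₁ := D.e₁.symm.toLinearMap ∘ₗ LinearMap.inr A D.P (D.Q × D.Ω) ∘ₗ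
    LinearMap.inl A D.Q D.Ω
  have hg : ∀ q, g q = D.e₁.symm (0, q, 0) := fun q => rfl
  have hgk : ∀ q, g q ∈ LinearMap.ker f := fun q =>
    LinearMap.mem_ker.2 ((aux_ker D _).2 ⟨q, rfl⟩)
  refine ⟨LinearEquiv.ofBijective (g.codRestrict _ hgk) ⟨?_, ?_⟩⟩
  · intro a b h
    have h1 : g a = g b := congrArg Subtype.val h
    rw [hg, hg] at h1
    have := D.e₁.symm.injective h1
    simpa using this
  · rintro ⟨x, hx⟩
    obtain ⟨q, hq⟩ := (aux_ker D x).1 hx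
    exact ⟨q, Subtype.ext hq.symm⟩

theorem aux_M {A : Type} [Ring A] {M₁ M₀ : Type} [AddCommGroup M₁]
    [Module A M₁] [AddCommGroup M₀] [Module A M₀] {f : M₁ →ₗ[A] M₀}
    (D : ArrowDecomp A M₁ M₀ f) : Nonempty ((M₀ ⧸ LinearMap.range f) ≃ₗ[A] D.M) := by
  let g : M₀ →ₗ[A] D.M := D.π ∘ₗ LinearMap.snd A D.P D.PM ∘ₗ D.e₀.toLinearMap
  have hg : ∀ x, g x = D.π (D.e₀ x).2 := fun x => rfl
  have hs : Function.Surjective g := by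
    intro m
    obtain ⟨p, rfl⟩ := D.surjπ m
    exact ⟨D.e₀.symm (0, p), by simp [hg]⟩
  have hk : LinearMap.range f = LinearMap.ker g := by
    ext x
    rw [LinearMap.mem_ker, hg, ← LinearMap.mem_ker, D.exact]
    constructor
    · rintro ⟨y, rfl⟩
      exact ⟨(D.e₁ y).2.2, by rw [D.comm]⟩
    · rintro ⟨w, hw⟩
      refine ⟨D.e₁.symm ((D.e₀ x).1, 0, w), ?_⟩
      apply D.e₀.injective
      rw [D.comm]
      simp [hw]
  exact ⟨(Submodule.quotEquivOfEq _ _ hk).trans (g.quotKerEquivOfSurjective hs)⟩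

theorem aux_exists {A : Type} [Ring A] [IsArtinianRing A]
    (hered : ∀ (N : Type) [AddCommGroup N] [Module A N], Module.Projective A N →
      ∀ L : Submodule A N, Module.Projective A L)
    (M₁ M₀ : Type) [AddCommGroup M₁] [Module A M₁] [AddCommGroup M₀] [Module A M₀]
    [Module.Finite A M₁] [Module.Finite A M₀]
    (hM₁ : Module.Projective A M₁) (hM₀ : Module.Projective A M₀)
    (f : M₁ →ₗ[A] M₀) :
    Nonempty (ArrowDecomp A M₁ M₀ f) := by
  set I := LinearMap.range f with hI
  obtain ⟨X, hX, hmin⟩ := WellFounded.has_min (r := ((· < ·) : Submodule A M₀ → _ → Prop))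
    wellFounded_lt {X | X ⊔ I = ⊤} ⟨⊤, by simp⟩
  have hX : X ⊔ I = ⊤ := hX
  have hmin : ∀ N, N ≤ X → N ⊔ I = ⊤ → N = X := fun N hN h =>
    hN.eq_of_not_lt (hmin N h)
  -- lift
  have hqs : Function.Surjective (I.mkQ ∘ₗ X.subtype) := by
    intro m
    obtain ⟨m, rfl⟩ := I.mkQ_surjective m
    obtain ⟨x, hx, i, hi, rfl⟩ := Submodule.mem_sup.1 (hX ▸ Submodule.mem_top : m ∈ X ⊔ I)
    refine ⟨⟨x, hx⟩, ?_⟩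
    simp [(Submodule.Quotient.mk_eq_zero I).2 hi]
  obtain ⟨g, hg⟩ := Module.projective_lifting_property (I.mkQ ∘ₗ X.subtype) I.mkQ hqs
  have hg : ∀ x, (g x : M₀) - x ∈ I := fun x =>
    (Submodule.Quotient.eq I).1 (LinearMap.congr_fun hg x)
  let g' : X →ₗ[A] X := g ∘ₗ X.subtype
  have hg's : Function.Surjective g' := by
    have h1 : Submodule.map X.subtype (LinearMap.range g') = X := by
      apply hmin _ (Submodule.map_subtype_le _ _)
      rw [eq_top_iff, ← hX]
      refine sup_le ?_ le_sup_right
      intro x hx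
      refine Submodule.mem_sup.2 ⟨g x, ⟨g x, ⟨⟨x, hx⟩, rfl⟩, rfl⟩, -((g x : M₀) - x),
        I.neg_mem (hg x), by abel⟩
    rw [← LinearMap.range_eq_top]
    apply Submodule.map_injective_of_injective X.subtype_injective
    rw [h1]; simp
  have hg'i : Function.Injective g' := IsNoetherian.injective_of_surjective_endomorphism _ hg's
  let e := LinearEquiv.ofBijective g' ⟨hg'i, hg's⟩
  let r : M₀ →ₗ[A] X := e.symm.toLinearMap ∘ₗ g
  have hr : ∀ x : X, r x = x := fun x => e.symm_apply_apply x
  let P := LinearMap.ker r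
  have hPI : P ≤ I := by
    intro x hx
    have h1 : g x = 0 := by
      have : e.symm (g x) = 0 := hx
      simpa using this
    have := hg x
    rw [h1] at this
    simpa using this
  have hcompl : ∀ x, x - (r x : M₀) ∈ P := by
    intro x
    rw [LinearMap.mem_ker, map_sub, hr, sub_self]
  let p : M₀ →ₗ[A] P := (LinearMap.id - X.subtype ∘ₗ r).codRestrict P hcompl
  have hp : ∀ x, (p x : M₀) = x - r x := fun x => rfl
  let e₀ : M₀ ≃ₗ[A] P × X := LinearEquiv.ofLinearMap (p.prod r) (P.subtype.coprod X.subtype)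
    (by
      apply LinearMap.ext
      rintro ⟨a, b⟩
      have ha : r a = 0 := a.2
      refine Prod.ext (Subtype.ext ?_) (Subtype.ext ?_) <;> simp [hp, hr, ha])
    (by
      apply LinearMap.ext
      intro x
      simp [hp])
  have he₀ : ∀ x, e₀ x = (p x, r x) := fun x => rfl
  let Ω : Submodule A X := Submodule.comap X.subtype I
  have hrI : ∀ y, r (f y) ∈ Ω := by
    intro y
    change (r (f y) : M₀) ∈ I
    have h1 : f y ∈ I := ⟨y, rfl⟩
    have h2 := I.sub_mem h1 (hPI (hcompl (f y)))
    simpa using h2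
  let s : M₁ →ₗ[A] P × Ω := (p ∘ₗ f).prod ((r ∘ₗ f).codRestrict Ω hrI)
  have hs : ∀ y, s y = (p (f y), ⟨r (f y), hrI y⟩) := fun y => rfl
  have hss : Function.Surjective s := by
    rintro ⟨a, ⟨b, hb⟩⟩
    have ha : r a = 0 := a.2
    obtain ⟨y, hy⟩ : (a : M₀) + b ∈ I := I.add_mem (hPI a.2) hb
    refine ⟨y, ?_⟩
    rw [hs]
    refine Prod.ext (Subtype.ext ?_) (Subtype.ext ?_)
    · simp [hp, hy, hr, ha]
    · simp [hy, hr, ha]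
  haveI pP : Module.Projective A P := hered M₀ hM₀ P
  haveI pX : Module.Projective A X := hered M₀ hM₀ X
  haveI pΩ : Module.Projective A Ω := hered X pX Ω
  obtain ⟨t, ht⟩ := Module.projective_lifting_property s LinearMap.id hss
  have ht : ∀ z, s (t z) = z := fun z => LinearMap.congr_fun ht z
  let Q := LinearMap.ker s
  let q : M₁ →ₗ[A] Q := (LinearMap.id - t ∘ₗ s).codRestrict Q (by
    intro x
    rw [LinearMap.mem_ker]
    simp [ht])
  have hq : ∀ x, (q x : M₁) = x - t (s x) := fun x => rfl
  let e₁ : M₁ ≃ₗ[A] P × Q × Ω := LinearEquiv.ofBijective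
    ((LinearMap.fst A P Ω ∘ₗ s).prod (q.prod (LinearMap.snd A P Ω ∘ₗ s))) (by
      constructor
      · rw [← LinearMap.ker_eq_bot, LinearMap.ker_eq_bot']
        intro x hx
        have h1 : (s x).1 = 0 := congrArg Prod.fst hx
        have h2 : q x = 0 := congrArg (fun z => z.2.1) hx
        have h3 : (s x).2 = 0 := congrArg (fun z => z.2.2) hx
        have h4 : s x = 0 := Prod.ext h1 h3
        have h5 := hq x
        rw [h2, h4] at h5
        simpa using h5.symm
      · rintro ⟨a, b, c⟩
        have hb : s b = 0 := b.2
        have h1 : s (b + t (a, c)) = (a, c) := by rw [map_add, hb, ht, zero_add]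
        refine ⟨b + t (a, c), ?_⟩
        refine Prod.ext ?_ (Prod.ext (Subtype.ext ?_) ?_)
        · change (s (b + t (a, c))).1 = a
          rw [h1]
        · change (b : M₁) + t (a, c) - t (s (b + t (a, c))) = b
          rw [h1]; abel
        · change (s (b + t (a, c))).2 = c
          rw [h1])
  exact ⟨{
    P := P, Q := Q, Ω := Ω, PM := X, M := X ⧸ Ω
    projP := pP
    projQ := hered M₁ hM₁ Q
    projΩ := pΩ
    projPM := pX
    δ := Ω.subtype
    π := Ω.mkQ
    injδ := Ω.subtype_injective
    surjπ := Ω.mkQ_surjective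
    exact := by simp
    minimal := by
      intro N hN
      rw [Submodule.range_subtype] at hN
      have h1 : Submodule.map X.subtype N = X := by
        apply hmin _ (Submodule.map_subtype_le _ _)
        rw [eq_top_iff, ← hX]
        refine sup_le ?_ le_sup_right
        intro x hx
        obtain ⟨n, hn, w, hw, h⟩ := Submodule.mem_sup.1
          (hN ▸ Submodule.mem_top : (⟨x, hx⟩ : X) ∈ N ⊔ Ω)
        exact Submodule.mem_sup.2 ⟨n, ⟨n, hn, rfl⟩, w, hw, congrArg Subtype.val h⟩
      apply Submodule.map_injective_of_injective X.subtype_injective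
      rw [h1]; simp
    e₁ := e₁
    e₀ := e₀
    comm := fun x => rfl }⟩

/-- Lemma 2.4: every object of `C₂(𝒫)` decomposes as `K_P ⊕ Z_Q ⊕ C_M`, and the modules
`P`, `Q`, `M` are unique up to isomorphism. -/
theorem stmt_7 (k : Type) [Field k] (A : Type) [Ring A] [Algebra k A]
    [FiniteDimensional k A]
    (hered : ∀ (N : Type) [AddCommGroup N] [Module A N], Module.Projective A N →
      ∀ L : Submodule A N, Module.Projective A L)
    (M₁ M₀ : Type) [AddCommGroup M₁] [Module A M₁] [AddCommGroup M₀] [Module A M₀]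
    [Module.Finite A M₁] [Module.Finite A M₀]
    (hM₁ : Module.Projective A M₁) (hM₀ : Module.Projective A M₀)
    (f : M₁ →ₗ[A] M₀) :
    Nonempty (ArrowDecomp A M₁ M₀ f) ∧
      ∀ (D D' : ArrowDecomp A M₁ M₀ f),
        Nonempty (D.P ≃ₗ[A] D'.P) ∧ Nonempty (D.Q ≃ₗ[A] D'.Q) ∧
          Nonempty (D.M ≃ₗ[A] D'.M) := by
  haveI : IsArtinianRing A := IsArtinianRing.of_finite k A
  refine ⟨aux_exists hered M₁ M₀ hM₁ hM₀ f, fun D D' => ⟨aux_P D D', ?_, ?_⟩⟩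
  · obtain ⟨a⟩ := aux_Q D
    obtain ⟨b⟩ := aux_Q D'
    exact ⟨a.trans b.symm⟩
  · obtain ⟨a⟩ := aux_M D
    obtain ⟨b⟩ := aux_M D'
    exact ⟨a.symm.trans b⟩
end

section
/- For any objects M_• = (M₋₁ → M₀) and N_• = (N₋₁ → N₀) of C₂(𝒫), one has dim_k Hom_{C₂(𝒜)}(M_•, N_•) − dim_k Ext¹_{C₂(𝒜)}(M_•, N_•) = dim_k Hom_A(M₀, N₀) + dim_k Hom_A(M₋₁, N₋₁) − dim_k Hom_A(M₋₁, N₀). (The Euler form formula on the morphism category, Lemma 2.9 of [DXZ], used throughout the paper.) -/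
open CategoryTheory Module

namespace EulerAux
open Limits
universe v u
noncomputable section
variable {C : Type u} [Category.{v} C] [Abelian C]

def cx (S : ShortComplex C) : ChainComplex C ℕ :=
  ChainComplex.augment ((ChainComplex.single₀ C).obj S.X₁) (X := S.X₂) S.f
    ((congrArg (· ≫ S.f) (HomologicalComplex.single_obj_d _ _ _ _ _)).trans zero_comp)

lemma cx_isZero (S : ShortComplex C) (n : ℕ) : IsZero ((cx S).X (n + 2)) :=
  HomologicalComplex.isZero_single_obj_X (ComplexShape.down ℕ) 0 S.X₁ (n + 1) (by simp)

lemma cx_proj (S : ShortComplex C) [Projective S.X₁] [Projective S.X₂] (n : ℕ) :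
    Projective ((cx S).X n) := by
  obtain (_ | _ | n) := n
  · exact inferInstanceAs (Projective S.X₂)
  · exact inferInstanceAs (Projective S.X₁)
  · exact (cx_isZero S n).projective

def res (S : ShortComplex C) (hS : S.ShortExact) [Projective S.X₁] [Projective S.X₂] :
    ProjectiveResolution S.X₃ where
  complex := cx S
  projective := cx_proj S
  π := (ChainComplex.toSingle₀Equiv _ _).symm ⟨S.g, S.zero⟩
  quasiIso := ⟨fun n => by
    cases n
    · rw [ChainComplex.quasiIsoAt₀_iff, ShortComplex.quasiIso_iff_of_zeros']
      · refine (ShortComplex.exact_and_epi_g_iff_of_iso ?_).2 ⟨hS.exact, hS.epi_g⟩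
        refine ShortComplex.isoMk (Iso.refl _) (Iso.refl _) (Iso.refl _) ?_ ?_
        · exact (Category.id_comp _).trans (Category.comp_id _).symm
        · refine (Category.id_comp _).trans (Eq.trans ?_ (Category.comp_id _).symm)
          exact (ChainComplex.toSingle₀Equiv_symm_apply_f_zero (C := cx S) S.g S.zero).symm
      all_goals rfl
    · rename_i n
      rw [quasiIsoAt_iff_exactAt']
      · rw [HomologicalComplex.exactAt_iff' _ (n + 1 + 1) (n + 1) n (by simp) (by simp)]
        cases n
        · have := hS.mono_f
          refine (ShortComplex.exact_iff_mono _ ?_).2 hS.mono_f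
          exact (cx_isZero S 0).eq_of_src _ _
        · apply ShortComplex.exact_of_isZero_X₂
          rename_i n
          exact cx_isZero S n
      · apply ChainComplex.exactAt_succ_single_obj⟩

variable (k : Type) [Field k] [Linear k C] [EnoughProjectives C]

lemma finrank_ext (S : ShortComplex C) (hS : S.ShortExact) [Projective S.X₁] [Projective S.X₂]
    (Y : C) [FiniteDimensional k (S.X₁ ⟶ Y)] [FiniteDimensional k (S.X₂ ⟶ Y)] :
    (finrank k (S.X₃ ⟶ Y) : ℤ) - finrank k (((Ext k C 1).obj (Opposite.op S.X₃)).obj Y)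
      = (finrank k (S.X₂ ⟶ Y) : ℤ) - finrank k (S.X₁ ⟶ Y) := by
  let φ : (S.X₂ ⟶ Y) →ₗ[k] (S.X₁ ⟶ Y) := Linear.leftComp k Y S.f
  let ψ : (S.X₃ ⟶ Y) →ₗ[k] (S.X₂ ⟶ Y) := Linear.leftComp k Y S.g
  have hψ : Function.Injective ψ := by
    have := hS.epi_g
    intro a b h
    exact (cancel_epi S.g).1 h
  have hr : LinearMap.range ψ = LinearMap.ker φ := by
    have := hS.epi_g
    ext x
    constructor
    · rintro ⟨y, rfl⟩
      change S.f ≫ S.g ≫ y = 0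
      simp
    · intro (h : S.f ≫ x = 0)
      exact ⟨hS.exact.desc x h, hS.exact.g_desc x h⟩
  have h1 : finrank k (S.X₃ ⟶ Y) = finrank k (LinearMap.ker φ) := by
    rw [← hr]; exact (LinearMap.finrank_range_of_inj hψ).symm
  let K := (res S hS).complex.linearYonedaObj k Y
  have e1 := ((res S hS).isoExt (R := k) 1 Y).toLinearEquiv.finrank_eq
  have e2 : finrank k (K.homology 1) = finrank k ((S.X₁ ⟶ Y) ⧸ LinearMap.range φ) := by
    let T := K.sc' 0 1 2
    have hz : T.g = 0 := by
      ext (x : _ ⟶ _)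
      exact (cx_isZero S 0).eq_of_src _ _
    have i1 : K.homology 1 ≅ T.homology :=
      ShortComplex.homologyMapIso (K.isoSc' 0 1 2 (by simp) (by simp))
    have : IsIso T.homologyι := ShortComplex.isIso_homologyι _ hz
    have i2 := i1 ≪≫ asIso T.homologyι ≪≫ T.moduleCatOpcyclesIso
    exact i2.toLinearEquiv.finrank_eq
  have h2 := LinearMap.finrank_range_add_finrank_ker φ
  have h3 := Submodule.finrank_quotient_add_finrank (LinearMap.range φ)
  rw [e1, h1]
  change _ - (finrank k (K.homology 1) : ℤ) = _
  rw [e2]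
  omega


end

noncomputable section
open ComposableArrows ZeroObject
variable {D : Type u} [Category.{v} D] [Abelian D] {M₁ M₀ : D} (f : M₁ ⟶ M₀)

abbrev Q₀ (M₁ M₀ : D) : ComposableArrows D 1 := mk₁ (biprod.inr : M₁ ⟶ M₀ ⊞ M₁)
abbrev Q₁ (M₁ : D) : ComposableArrows D 1 := mk₁ (0 : (0 : D) ⟶ M₁)

def dd : Q₁ M₁ ⟶ Q₀ M₁ M₀ :=
  homMk₁ (0 : (0 : D) ⟶ M₁) (biprod.lift (-f) (𝟙 M₁))
    ((zero_comp : (0 : (0 : D) ⟶ M₁) ≫ _ = 0).trans zero_comp.symm)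

def pp : Q₀ M₁ M₀ ⟶ mk₁ f :=
  homMk₁ (𝟙 M₁) (biprod.desc (𝟙 M₀) f) (by
    change biprod.inr ≫ biprod.desc (𝟙 M₀) f = 𝟙 M₁ ≫ f
    simp)

lemma dd_pp : dd f ≫ pp f = 0 := by
  apply hom_ext₁
  · exact zero_comp
  · change biprod.lift (-f) (𝟙 M₁) ≫ biprod.desc (𝟙 M₀) f = 0
    simp

abbrev SS : ShortComplex (ComposableArrows D 1) := ShortComplex.mk _ _ (dd_pp f)

lemma L1 {Z : D} (a b : Z ⟶ M₁)
    (h : a ≫ biprod.lift (-f) (𝟙 M₁) = b ≫ biprod.lift (-f) (𝟙 M₁)) : a = b := by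
  simpa using congrArg (· ≫ biprod.snd) h

lemma L2 {Z : D} (a b : M₀ ⟶ Z)
    (h : biprod.desc (𝟙 M₀) f ≫ a = biprod.desc (𝟙 M₀) f ≫ b) : a = b := by
  simpa using congrArg (biprod.inl ≫ ·) h

lemma L3 {Z : D} (h : Z ⟶ M₀ ⊞ M₁) (h1 : h ≫ biprod.desc (𝟙 M₀) f = 0) :
    (h ≫ biprod.snd) ≫ biprod.lift (-f) (𝟙 M₁) = h := by
  rw [biprod.desc_eq] at h1
  simp only [Category.comp_id, Preadditive.comp_add] at h1
  apply biprod.hom_ext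
  · simp [eq_neg_of_add_eq_zero_left h1]
  · simp

lemma L4 {Z W : D} (u : Z ⟶ W) (h : W ⟶ M₀ ⊞ M₁) (x : Z ⟶ M₁) (hx : x = 0)
    (e : u ≫ h = x ≫ biprod.inr) : u ≫ h ≫ biprod.snd = 0 := by
  rw [← Category.assoc, e, hx]; simp

lemma L5 {E₀ E₁ X₀ X₁ : D} (s : M₁ ⟶ E₀) (t : M₀ ⟶ E₁) (u : E₀ ⟶ E₁) (w : X₀ ⟶ X₁)
    (a : E₀ ⟶ X₀) (b : E₁ ⟶ X₁) (p : M₁ ⟶ X₀) (q : M₀ ⊞ M₁ ⟶ X₁)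
    (hs : s ≫ a = p) (ht : t ≫ b = biprod.inl ≫ q) (h1 : u ≫ b = a ≫ w)
    (h2 : biprod.inr ≫ q = p ≫ w) : biprod.desc t (s ≫ u) ≫ b = q := by
  apply biprod.hom_ext'
  · simp [ht]
  · rw [biprod.inr_desc_assoc, Category.assoc, h1, reassoc_of% hs, h2]

lemma L6 {Z : D} (p : M₀ ⊞ M₁ ⟶ Z) (q : M₁ ⟶ Z) (h : biprod.inr ≫ p = q) :
    biprod.desc (biprod.inl ≫ p) q = p := by
  apply biprod.hom_ext'
  · simp
  · simp [h]

instance : Mono (dd f) := by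
  constructor
  intro Z a b h
  apply hom_ext₁
  · exact (isZero_zero D).eq_of_tgt _ _
  · have : app' a 1 ≫ biprod.lift (-f) (𝟙 M₁) = app' b 1 ≫ biprod.lift (-f) (𝟙 M₁) :=
      congrArg (fun t => app' t 1) h
    exact L1 f _ _ this

instance : Epi (pp f) := by
  constructor
  intro Z a b h
  apply hom_ext₁
  · have : 𝟙 M₁ ≫ app' a 0 = 𝟙 M₁ ≫ app' b 0 := congrArg (fun t => app' t 0) h
    exact (cancel_epi (𝟙 M₁)).1 this
  · have : biprod.desc (𝟙 M₀) f ≫ app' a 1 = biprod.desc (𝟙 M₀) f ≫ app' b 1 :=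
      congrArg (fun t => app' t 1) h
    exact L2 f _ _ this

lemma SS_exact : (SS f).ShortExact where
  exact := by
    refine ShortComplex.exact_of_f_is_kernel _ (KernelFork.IsLimit.ofι' _ _ fun {Z} h hh => ?_)
    have h0 : app' h 0 = 0 := by
      have : app' h 0 ≫ 𝟙 M₁ = 0 := congrArg (fun t => app' t 0) hh
      exact (Category.comp_id _).symm.trans this
    have h1 : app' h 1 ≫ biprod.desc (𝟙 M₀) f = 0 := congrArg (fun t => app' t 1) hh
    have hw : Z.map' 0 1 ≫ app' h 1 = app' h 0 ≫ biprod.inr := (h.naturality _)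
    refine ⟨homMk₁ (0 : Z.obj' 0 ⟶ (0 : D)) (app' h 1 ≫ biprod.snd : Z.obj' 1 ⟶ M₁) ?_, ?_⟩
    · refine Eq.trans ?_ zero_comp.symm
      exact L4 _ _ _ h0 hw
    · apply hom_ext₁
      · exact zero_comp.trans h0.symm
      · exact L3 f _ h1
  mono_f := inferInstanceAs (Mono (dd f))
  epi_g := inferInstanceAs (Epi (pp f))

instance [Projective M₁] : Projective (Q₁ M₁) where
  factors {E X} g e he := by
    have : Epi (e.app 1) := inferInstance
    let t : M₁ ⟶ E.obj 1 := Projective.factorThru (app' g 1 : M₁ ⟶ X.obj' 1) (e.app 1)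
    have ht : t ≫ e.app 1 = app' g 1 := Projective.factorThru_comp _ _
    refine ⟨homMk₁ (0 : (0 : D) ⟶ E.obj' 0) t ?_, ?_⟩
    · exact (isZero_zero D).eq_of_src _ _
    · apply hom_ext₁
      · exact (isZero_zero D).eq_of_src _ _
      · exact ht

instance [Projective M₁] [Projective M₀] : Projective (Q₀ M₁ M₀) where
  factors {E X} g e he := by
    have : Epi (e.app 1) := inferInstance
    have : Epi (e.app 0) := inferInstance
    let s : M₁ ⟶ E.obj 0 := Projective.factorThru (app' g 0 : M₁ ⟶ X.obj' 0) (e.app 0)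
    let t : M₀ ⟶ E.obj 1 :=
      Projective.factorThru (biprod.inl ≫ (app' g 1 : M₀ ⊞ M₁ ⟶ X.obj' 1)) (e.app 1)
    have hs : s ≫ e.app 0 = app' g 0 := Projective.factorThru_comp _ _
    have ht : t ≫ e.app 1 = biprod.inl ≫ (app' g 1 : M₀ ⊞ M₁ ⟶ X.obj' 1) :=
      Projective.factorThru_comp _ _
    refine ⟨homMk₁ s (biprod.desc t (s ≫ E.map' 0 1) : M₀ ⊞ M₁ ⟶ E.obj' 1) ?_, ?_⟩
    · exact biprod.inr_desc _ _
    · apply hom_ext₁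
      · exact hs
      · exact L5 s t _ _ _ _ _ _ hs ht (e.naturality _)
          (g.naturality (homOfLE (by decide) : (0 : Fin 2) ⟶ 1))

variable (k : Type) [Field k] [Linear k D] {N₁ N₀ : D} (g : N₁ ⟶ N₀)

def e₁ : (Q₁ M₁ ⟶ mk₁ g) ≃ₗ[k] (M₁ ⟶ N₀) where
  toFun h := app' h 1
  map_add' _ _ := rfl
  map_smul' _ _ := rfl
  invFun t := homMk₁ (0 : (0 : D) ⟶ N₁) t ((isZero_zero D).eq_of_src _ _)
  left_inv h := by
    apply hom_ext₁
    · exact (isZero_zero D).eq_of_src _ _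
    · rfl
  right_inv _ := rfl

def e₀ : (Q₀ M₁ M₀ ⟶ mk₁ g) ≃ₗ[k] (M₀ ⟶ N₀) × (M₁ ⟶ N₁) where
  toFun h := (biprod.inl ≫ (app' h 1 : M₀ ⊞ M₁ ⟶ N₀), app' h 0)
  map_add' a b := Prod.ext (Preadditive.comp_add _ _ _ _ _ _) rfl
  map_smul' r a := Prod.ext (Linear.comp_smul _ _ _ _ _ _) rfl
  invFun t := homMk₁ t.2 (biprod.desc t.1 (t.2 ≫ g)) (biprod.inr_desc _ _)
  left_inv h := by
    apply hom_ext₁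
    · rfl
    · exact L6 _ _ (h.naturality (homOfLE (by decide) : (0 : Fin 2) ⟶ 1))
  right_inv t := Prod.ext (biprod.inl_desc _ _) rfl

lemma euler [EnoughProjectives (ComposableArrows D 1)] [Projective M₁] [Projective M₀]
    [FiniteDimensional k (M₀ ⟶ N₀)] [FiniteDimensional k (M₁ ⟶ N₁)]
    [FiniteDimensional k (M₁ ⟶ N₀)] :
    (finrank k (mk₁ f ⟶ mk₁ g) : ℤ)
        - finrank k (((Ext k (ComposableArrows D 1) 1).obj
            (Opposite.op (mk₁ f))).obj (mk₁ g))
      = (finrank k (M₀ ⟶ N₀) : ℤ) + finrank k (M₁ ⟶ N₁) - finrank k (M₁ ⟶ N₀) := by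
  have : FiniteDimensional k (Q₁ M₁ ⟶ mk₁ g) := (e₁ k g).symm.finiteDimensional
  have : FiniteDimensional k (Q₀ M₁ M₀ ⟶ mk₁ g) := (e₀ k g).symm.finiteDimensional
  have h := finrank_ext k (SS f) (SS_exact f) (mk₁ g)
  have h1 := (e₁ (M₁ := M₁) k g).finrank_eq
  have h0 := (e₀ (M₁ := M₁) (M₀ := M₀) k g).finrank_eq
  rw [finrank_prod] at h0
  refine h.trans ?_
  change (finrank k (Q₀ M₁ M₀ ⟶ mk₁ g) : ℤ) - finrank k (Q₁ M₁ ⟶ mk₁ g) = _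
  rw [h1, h0]
  push_cast
  ring

end

lemma finite_hom (k : Type) [Field k] (A : Type) [Ring A] [Algebra k A]
    [FiniteDimensional k A] (M N : ModuleCat.{v} A) [Module.Finite A M] [Module.Finite A N] :
    FiniteDimensional k (M ⟶ N) := by
  letI := ModuleCat.moduleOfAlgebraModule (k := k) M
  letI := ModuleCat.moduleOfAlgebraModule (k := k) N
  haveI := ModuleCat.isScalarTower_of_algebra_moduleCat (k := k) M
  haveI := ModuleCat.isScalarTower_of_algebra_moduleCat (k := k) N
  haveI : FiniteDimensional k M := Module.Finite.trans A M
  haveI : FiniteDimensional k N := Module.Finite.trans A N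
  let F : (M ⟶ N) →ₗ[k] (M →ₗ[k] N) :=
    { toFun h := h.hom.restrictScalars k
      map_add' _ _ := rfl
      map_smul' _ _ := rfl }
  refine FiniteDimensional.of_injective F ?_
  intro a b h
  ext x
  exact LinearMap.congr_fun h x

end EulerAux

/-- Lemma 2.9 of [DXZ]: the Euler form of the morphism category `C₂(𝒫)`.  Here `C₂(𝒜)` is
realized as the category `ComposableArrows (ModuleCat A) 1 = (Fin 2 ⥤ ModuleCat A)` of
arrows of `A`-modules, which is abelian, and `Ext` is its first Ext group. -/
theorem stmt_10 (k : Type) [Field k] (A : Type) [Ring A] [Algebra k A]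
    [FiniteDimensional k A]
    (hered : ∀ (N : ModuleCat A), Module.Projective A N →
      ∀ L : Submodule A N, Module.Projective A L)
    [EnoughProjectives (ComposableArrows (ModuleCat A) 1)]
    (M₁ M₀ N₁ N₀ : ModuleCat A)
    [Module.Finite A M₁] [Module.Finite A M₀] [Module.Finite A N₁] [Module.Finite A N₀]
    (hM₁ : Module.Projective A M₁) (hM₀ : Module.Projective A M₀)
    (hN₁ : Module.Projective A N₁) (hN₀ : Module.Projective A N₀)
    (f : M₁ ⟶ M₀) (g : N₁ ⟶ N₀) :
    (finrank k (ComposableArrows.mk₁ f ⟶ ComposableArrows.mk₁ g) : ℤ)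
        - finrank k (((Ext k (ComposableArrows (ModuleCat A) 1) 1).obj
            (Opposite.op (ComposableArrows.mk₁ f))).obj (ComposableArrows.mk₁ g))
      = (finrank k (M₀ ⟶ N₀) : ℤ) + finrank k (M₁ ⟶ N₁) - finrank k (M₁ ⟶ N₀) := by
  have := EulerAux.finite_hom k A M₀ N₀
  have := EulerAux.finite_hom k A M₁ N₁
  have := EulerAux.finite_hom k A M₁ N₀
  have : Projective M₁ := M₁.projective_of_categoryTheory_projective
  have : Projective M₀ := M₀.projective_of_categoryTheory_projective
  exact EulerAux.euler f k g
end

section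
/- The subcategory C_𝒜 of the bounded derived category D^b(𝒜), consisting of objects isomorphic to M ⊕ P[1] with M a finite-dimensional A-module and P a finite-dimensional projective A-module, is closed under extensions: for any distinguished triangle M[−1] ⊕ P → N ⊕ Q[1] → W → M ⊕ P[1] in D^b(𝒜) with M, N ∈ 𝒜 and P, Q ∈ 𝒫, the middle-extension object W is isomorphic to X ⊕ Y[1] for some module X ∈ 𝒜 and some projective module Y ∈ 𝒫. (Lemma 8.2.) -/
open CategoryTheory Limits Pretriangulated

namespace Stmt13Aux

universe w v u u₁ u₂ u₃

section Alg

variable {A : Type} [Ring A]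

lemma proj_sub_free
    (hered : ∀ (N : ModuleCat.{u₁} A), Module.Projective A N →
      ∀ L : Submodule A N, Module.Projective A L) (n : ℕ) (L : Submodule A (Fin n → A)) :
    Module.Projective A L := by
  let e : ULift.{u₁} (Fin n → A) ≃ₗ[A] (Fin n → A) := ULift.moduleEquiv
  have h := hered (ModuleCat.of A (ULift.{u₁} (Fin n → A)))
    (Module.Projective.of_equiv e.symm) (L.map e.symm.toLinearMap)
  exact Module.Projective.of_equiv (e.symm.submoduleMap L).symm

lemma proj_of_injective
    (hered : ∀ (N : ModuleCat.{u₁} A), Module.Projective A N →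
      ∀ L : Submodule A N, Module.Projective A L)
    {P : Type u₂} [AddCommGroup P] [Module A P] [Module.Finite A P] [Module.Projective A P]
    {L : Type u₃} [AddCommGroup L] [Module A L] (f : L →ₗ[A] P) (hf : Function.Injective f) :
    Module.Projective A L := by
  obtain ⟨n, p, hp⟩ := Module.Finite.exists_fin' A P
  obtain ⟨s, hs⟩ := Module.projective_lifting_property p LinearMap.id hp
  have hs' : Function.Injective s :=
    Function.LeftInverse.injective (g := p) (fun x => LinearMap.congr_fun hs x)
  have hi : Function.Injective (s ∘ₗ f) := hs'.comp hf
  have := proj_sub_free hered n (LinearMap.range (s ∘ₗ f))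
  exact Module.Projective.of_equiv (LinearEquiv.ofInjective _ hi).symm

lemma pd_le
    (hered : ∀ (N : ModuleCat.{u₁} A), Module.Projective A N →
      ∀ L : Submodule A N, Module.Projective A L)
    (X : ModuleCat.{u₂} A) [Module.Finite A X] : HasProjectiveDimensionLT X 2 := by
  obtain ⟨n, p, hp⟩ := Module.Finite.exists_fin' A X
  let q : ULift.{u₂} (Fin n → A) →ₗ[A] X := p ∘ₗ (ULift.moduleEquiv (R := A)).toLinearMap
  have hq : Function.Surjective q := hp.comp (ULift.moduleEquiv (R := A)).surjective
  have hF : Module.Projective A (ULift.{u₂} (Fin n → A)) :=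
    Module.Projective.of_equiv (ULift.moduleEquiv (R := A)).symm
  have hFf : Module.Finite A (ULift.{u₂} (Fin n → A)) :=
    Module.Finite.equiv (ULift.moduleEquiv (R := A)).symm
  have hK : Module.Projective A (LinearMap.ker q) :=
    proj_of_injective hered (LinearMap.ker q).subtype Subtype.val_injective
  let S : ShortComplex (ModuleCat.{u₂} A) :=
    ShortComplex.mk (ModuleCat.ofHom (LinearMap.ker q).subtype) (ModuleCat.ofHom q)
      (by ext x; exact x.2)
  have hS : S.ShortExact :=
    { exact := by
        rw [ShortComplex.moduleCat_exact_iff]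
        intro x hx
        exact ⟨⟨x, hx⟩, rfl⟩
      mono_f := (ModuleCat.mono_iff_injective _).2 Subtype.val_injective
      epi_g := (ModuleCat.epi_iff_surjective _).2 hq }
  have h1 : Projective S.X₁ := ModuleCat.projective_of_categoryTheory_projective
    (P := ModuleCat.of A (LinearMap.ker q))
  have h2 : Projective S.X₂ := ModuleCat.projective_of_categoryTheory_projective
    (P := ModuleCat.of A (ULift.{u₂} (Fin n → A)))
  exact hS.hasProjectiveDimensionLT_X₃ 1 inferInstance inferInstance

lemma proj_ext
    (hered : ∀ (N : ModuleCat.{u₁} A), Module.Projective A N →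
      ∀ L : Submodule A N, Module.Projective A L)
    (S : ShortComplex (ModuleCat.{u₂} A)) (hS : S.Exact) [Mono S.f]
    (h₁ : Module.Projective A S.X₁) (h₃ : Module.Projective A S.X₃) [Module.Finite A S.X₃] :
    Module.Projective A S.X₂ := by
  have hR : Module.Projective A (LinearMap.range S.g.hom) :=
    proj_of_injective hered (LinearMap.range S.g.hom).subtype Subtype.val_injective
  obtain ⟨s, hs⟩ := Module.projective_lifting_property S.g.hom.rangeRestrict LinearMap.id
    S.g.hom.surjective_rangeRestrict
  have hs' : ∀ x, S.g.hom.rangeRestrict (s x) = x := fun x => LinearMap.congr_fun hs x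
  rw [ShortComplex.moduleCat_exact_iff] at hS
  have hinj : Function.Injective S.f.hom := (ModuleCat.mono_iff_injective _).1 ‹_›
  have hz : ∀ x, S.g.hom (S.f.hom x) = 0 := fun x => S.moduleCat_zero_apply x
  let φ : (S.X₁ × LinearMap.range S.g.hom) →ₗ[A] S.X₂ := LinearMap.coprod S.f.hom s
  have hφ : Function.Bijective φ := by
    constructor
    · rw [← LinearMap.ker_eq_bot, LinearMap.ker_eq_bot']
      rintro ⟨a, b⟩ h
      have h' : S.f.hom a + s b = 0 := h
      have hb : b = 0 := by
        rw [← hs' b]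
        have := congrArg S.g.hom h'
        ext
        simpa [hz] using this
      subst hb
      have : a = 0 := hinj (by simpa using h')
      simp [this]
    · intro x
      have h0 : S.g.hom (x - s (S.g.hom.rangeRestrict x)) = 0 := by
        have := congrArg Subtype.val (hs' (S.g.hom.rangeRestrict x))
        exact (map_sub _ _ _).trans (sub_eq_zero.2 this.symm)
      obtain ⟨y, hy⟩ := hS _ h0
      refine ⟨(y, S.g.hom.rangeRestrict x), ?_⟩
      have hy' : S.f.hom y = x - s (S.g.hom.rangeRestrict x) := hy
      simp [φ, hy']
  exact Module.Projective.of_equiv (LinearEquiv.ofBijective φ hφ)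

lemma finite_ext [IsNoetherianRing A]
    (S : ShortComplex (ModuleCat.{u₂} A)) (hS : S.Exact)
    [Module.Finite A S.X₁] [Module.Finite A S.X₃] : Module.Finite A S.X₂ := by
  rw [ShortComplex.moduleCat_exact_iff_range_eq_ker] at hS
  have := isNoetherian_of_range_eq_ker S.f.hom S.g.hom hS
  infer_instance

end Alg

section Cat

variable {C : Type u} [Category.{v} C] [Abelian C] [HasDerivedCategory.{w} C]

open DerivedCategory

/-- The object `M[-n] ⊕ P[-m]`. -/
noncomputable abbrev D (n m : ℤ) (M P : C) : DerivedCategory C :=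
  DerivedCategory.Q.obj ((HomologicalComplex.single C (ComplexShape.up ℤ) n).obj M ⊞
    (HomologicalComplex.single C (ComplexShape.up ℤ) m).obj P)

noncomputable def homD (n m i : ℤ) (M P : C) :
    (homologyFunctor C i).obj (D n m M P) ≅
      ((HomologicalComplex.single C (ComplexShape.up ℤ) n).obj M).homology i ⊞
    ((HomologicalComplex.single C (ComplexShape.up ℤ) m).obj P).homology i :=
  haveI := preservesBinaryBiproducts_of_preservesBiproducts
    (HomologicalComplex.homologyFunctor C (ComplexShape.up ℤ) i)
  (homologyFunctorFactors C i).app _ ≪≫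
    (HomologicalComplex.homologyFunctor C (ComplexShape.up ℤ) i).mapBiprod _ _

lemma isZero_homD (n m i : ℤ) (M P : C) (hn : i ≠ n) (hm : i ≠ m) :
    IsZero ((homologyFunctor C i).obj (D n m M P)) := by
  refine IsZero.of_iso ?_ (homD n m i M P)
  rw [biprod_isZero_iff]
  exact ⟨HomologicalComplex.isZero_single_obj_homology _ _ _ _ hn,
    HomologicalComplex.isZero_single_obj_homology _ _ _ _ hm⟩

noncomputable def homDLeft (n m : ℤ) (M P : C) (h : n ≠ m) :
    (homologyFunctor C n).obj (D n m M P) ≅ M :=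
  homD n m n M P ≪≫ (isoBiprodZero
    (HomologicalComplex.isZero_single_obj_homology _ _ _ _ h)).symm ≪≫
    HomologicalComplex.singleObjHomologySelfIso _ _ _

noncomputable def homDRight (n m : ℤ) (M P : C) (h : m ≠ n) :
    (homologyFunctor C m).obj (D n m M P) ≅ P :=
  homD n m m M P ≪≫ (isoZeroBiprod
    (HomologicalComplex.isZero_single_obj_homology _ _ _ _ h)).symm ≪≫
    HomologicalComplex.singleObjHomologySelfIso _ _ _

lemma exists_split (W : DerivedCategory C) (hGE : W.IsGE (-1)) (hLE : W.IsLE 0)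
    (hpd : ∀ (X : C) (f : (homologyFunctor C 0).obj W ⟶ X), Epi f →
      HasProjectiveDimensionLT X 2) :
    ∃ X Y : C, Nonempty (W ≅ D 0 (-1) X Y) := by
  obtain ⟨a, b, ha, hb, f, g, h, hT⟩ := TStructure.t.exists_triangle W (-1) 0 (by simp)
  have ha : a.IsLE (-1) := ⟨ha⟩
  have hb : b.IsGE 0 := ⟨hb⟩
  have ha' : a.IsGE (-1) := by
    rw [isGE_iff]
    intro i hi
    exact (HomologySequence.exact₁ _ hT (i - 1) i (by lia)).isZero_of_both_zeros
      ((b.isZero_of_isGE 0 (i - 1) (by lia)).eq_of_src _ _)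
      ((W.isZero_of_isGE (-1) i hi).eq_of_tgt _ _)
  have hb' : b.IsLE 0 := by
    rw [isLE_iff]
    intro i hi
    exact (HomologySequence.exact₃ _ hT i (i + 1) (by lia)).isZero_of_both_zeros
      ((W.isZero_of_isLE 0 i hi).eq_of_src _ _)
      ((a.isZero_of_isLE (-1) (i + 1) (by lia)).eq_of_tgt _ _)
  obtain ⟨Y, ⟨eY⟩⟩ := exists_iso_singleFunctor_obj_of_isGE_of_isLE a (-1)
  obtain ⟨X, ⟨eX⟩⟩ := exists_iso_singleFunctor_obj_of_isGE_of_isLE b 0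
  have hepi : Epi ((homologyFunctor C 0).map g) :=
    (HomologySequence.epi_homologyMap_mor₂_iff _ hT 0 1 (by lia)).2
      ((a.isZero_of_isLE (-1) 1 (by lia)).eq_of_tgt _ _)
  have hX : HasProjectiveDimensionLT X 2 :=
    hpd X ((homologyFunctor C 0).map g ≫ (homologyFunctor C 0).map eX.hom ≫
      ((singleFunctorCompHomologyFunctorIso C 0).app X).hom) inferInstance
  have hh : h = 0 := by
    let := HasExt.standard C
    have hs : Subsingleton (Abelian.Ext X Y 2) := HasProjectiveDimensionLT.subsingleton X 2 2 le_rfl Y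
    have hs2 := (Abelian.Ext.homEquiv (X := X) (Y := Y) (n := 2)).symm.subsingleton
    let e : a⟦(1 : ℤ)⟧ ≅ ((singleFunctor C 0).obj Y)⟦((2 : ℕ) : ℤ)⟧ :=
      (shiftFunctor _ (1 : ℤ)).mapIso eY ≪≫
        ((singleFunctors C).shiftIso 1 (-2) (-1) (by lia)).app Y ≪≫
        (((singleFunctors C).shiftIso ((2 : ℕ) : ℤ) (-2) 0 (by lia)).app Y).symm
    have : eX.inv ≫ h ≫ e.hom = 0 := hs2.elim _ _
    simpa using this
  obtain ⟨e, -⟩ := exists_iso_binaryBiproduct_of_distTriang _ hT hh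
  haveI := preservesBinaryBiproducts_of_preservesBiproducts
    (DerivedCategory.Q (C := C))
  refine ⟨X, Y, ⟨?_⟩⟩
  exact e ≪≫ biprod.braiding _ _ ≪≫ biprod.mapIso eX eY ≪≫ (DerivedCategory.Q.mapBiprod _ _).symm

end Cat

end Stmt13Aux

/-- Lemma 8.2: the subcategory `C_𝒜` of `D^b(𝒜)` of objects `M ⊕ P[1]` (`M` a
finite-dimensional module, `P` a finite-dimensional projective module) is closed under
extensions: in any distinguished triangle
`M[-1] ⊕ P → N ⊕ Q[1] → W → M ⊕ P[1]` the object `W` is isomorphic to `X ⊕ Y[1]` for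
some module `X` and projective module `Y`.  Here `M ⊕ P[1]` is represented by the
complex `(single 0).obj M ⊞ (single (-1)).obj P` (and `M[-1] ⊕ P` by
`(single 1).obj M ⊞ (single 0).obj P`). -/
theorem stmt_13 (k : Type) [Field k] (A : Type) [Ring A] [Algebra k A]
    [FiniteDimensional k A]
    (hered : ∀ (N : ModuleCat A), Module.Projective A N →
      ∀ L : Submodule A N, Module.Projective A L)
    [HasDerivedCategory (ModuleCat A)]
    (M N P Q : ModuleCat A)
    [Module.Finite A M] [Module.Finite A N] [Module.Finite A P] [Module.Finite A Q]
    (hP : Module.Projective A P) (hQ : Module.Projective A Q)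
    (T : Triangle (DerivedCategory (ModuleCat A)))
    (hT : T ∈ distTriang (DerivedCategory (ModuleCat A)))
    (e₁ : T.obj₁ ≅ DerivedCategory.Q.obj
      ((HomologicalComplex.single (ModuleCat A) (ComplexShape.up ℤ) 1).obj M ⊞
        (HomologicalComplex.single (ModuleCat A) (ComplexShape.up ℤ) 0).obj P))
    (e₂ : T.obj₂ ≅ DerivedCategory.Q.obj
      ((HomologicalComplex.single (ModuleCat A) (ComplexShape.up ℤ) 0).obj N ⊞
        (HomologicalComplex.single (ModuleCat A) (ComplexShape.up ℤ) (-1)).obj Q)) :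
    ∃ (X Y : ModuleCat A), Module.Finite A X ∧ Module.Finite A Y ∧
      Module.Projective A Y ∧
      Nonempty (T.obj₃ ≅ DerivedCategory.Q.obj
        ((HomologicalComplex.single (ModuleCat A) (ComplexShape.up ℤ) 0).obj X ⊞
          (HomologicalComplex.single (ModuleCat A) (ComplexShape.up ℤ) (-1)).obj Y)) := by
  have hN : IsNoetherianRing A := IsNoetherianRing.of_finite k A
  have hGE : T.obj₃.IsGE (-1) := by
    rw [DerivedCategory.isGE_iff]
    intro i hi
    exact (DerivedCategory.HomologySequence.exact₃ _ hT i (i + 1) (by lia)).isZero_of_both_zeros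
      ((IsZero.of_iso (Stmt13Aux.isZero_homD 0 (-1) i N Q (by lia) (by lia))
        ((DerivedCategory.homologyFunctor (ModuleCat A) i).mapIso e₂)).eq_of_src _ _)
      ((IsZero.of_iso (Stmt13Aux.isZero_homD 1 0 (i + 1) M P (by lia) (by lia))
        ((DerivedCategory.homologyFunctor (ModuleCat A) (i + 1)).mapIso e₁)).eq_of_tgt _ _)
  have hLE : T.obj₃.IsLE 0 := by
    rw [DerivedCategory.isLE_iff]
    intro i hi
    exact (DerivedCategory.HomologySequence.exact₃ _ hT i (i + 1) (by lia)).isZero_of_both_zeros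
      ((IsZero.of_iso (Stmt13Aux.isZero_homD 0 (-1) i N Q (by lia) (by lia))
        ((DerivedCategory.homologyFunctor (ModuleCat A) i).mapIso e₂)).eq_of_src _ _)
      ((IsZero.of_iso (Stmt13Aux.isZero_homD 1 0 (i + 1) M P (by lia) (by lia))
        ((DerivedCategory.homologyFunctor (ModuleCat A) (i + 1)).mapIso e₁)).eq_of_tgt _ _)
  let iM := ((DerivedCategory.homologyFunctor (ModuleCat A) 1).mapIso e₁ ≪≫ Stmt13Aux.homDLeft 1 0 M P (by lia)).toLinearEquiv
  let iP := ((DerivedCategory.homologyFunctor (ModuleCat A) 0).mapIso e₁ ≪≫ Stmt13Aux.homDRight 1 0 M P (by lia)).toLinearEquiv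
  let iN := ((DerivedCategory.homologyFunctor (ModuleCat A) 0).mapIso e₂ ≪≫ Stmt13Aux.homDLeft 0 (-1) N Q (by lia)).toLinearEquiv
  let iQ := ((DerivedCategory.homologyFunctor (ModuleCat A) (-1)).mapIso e₂ ≪≫ Stmt13Aux.homDRight 0 (-1) N Q (by lia)).toLinearEquiv
  have fM := Module.Finite.equiv iM.symm
  have fP := Module.Finite.equiv iP.symm
  have fN := Module.Finite.equiv iN.symm
  have fQ := Module.Finite.equiv iQ.symm
  have pP := Module.Projective.of_equiv iP.symm
  have pQ := Module.Projective.of_equiv iQ.symm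
  have fX : Module.Finite A ((DerivedCategory.homologyFunctor (ModuleCat A) 0).obj T.obj₃) :=
    @Stmt13Aux.finite_ext _ _ _ _ (DerivedCategory.HomologySequence.exact₃ _ hT 0 1 (by lia)) fN fM
  have fY : Module.Finite A ((DerivedCategory.homologyFunctor (ModuleCat A) (-1)).obj T.obj₃) :=
    @Stmt13Aux.finite_ext _ _ _ _ (DerivedCategory.HomologySequence.exact₃ _ hT (-1) 0 (by lia)) fQ fP
  have hmono : Mono ((DerivedCategory.homologyFunctor (ModuleCat A) (-1)).map T.mor₂) :=
    (DerivedCategory.HomologySequence.mono_homologyMap_mor₂_iff _ hT (-1)).2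
      ((IsZero.of_iso (Stmt13Aux.isZero_homD 1 0 (-1) M P (by lia) (by lia))
        ((DerivedCategory.homologyFunctor (ModuleCat A) (-1)).mapIso e₁)).eq_of_src _ _)
  have pY : Module.Projective A ((DerivedCategory.homologyFunctor (ModuleCat A) (-1)).obj T.obj₃) :=
    @Stmt13Aux.proj_ext _ _ hered _ (DerivedCategory.HomologySequence.exact₃ _ hT (-1) 0 (by lia)) hmono pQ pP fP
  obtain ⟨X, Y, ⟨e⟩⟩ := Stmt13Aux.exists_split T.obj₃ hGE hLE (fun X f hf => by
    have : Module.Finite A X := Module.Finite.of_surjective f.hom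
      ((ModuleCat.epi_iff_surjective _).1 hf)
    exact Stmt13Aux.pd_le hered X)
  let iX := ((DerivedCategory.homologyFunctor (ModuleCat A) 0).mapIso e ≪≫ Stmt13Aux.homDLeft 0 (-1) X Y (by lia)).toLinearEquiv
  let iY := ((DerivedCategory.homologyFunctor (ModuleCat A) (-1)).mapIso e ≪≫ Stmt13Aux.homDRight 0 (-1) X Y (by lia)).toLinearEquiv
  exact ⟨X, Y, Module.Finite.equiv iX, Module.Finite.equiv iY, Module.Projective.of_equiv iY, ⟨e⟩⟩
end

section
/- Let k be a finite field, A a finite-dimensional k-algebra, and let B, M, P, Q be finite-dimensional left A-modules. Then the number of A-linear maps f : P → M with Ker(f) ≅ Q and Coker(f) ≅ B equals the sum, over all submodules L' ⊆ M with M/L' ≅ B, of |Aut_A(L')| · |{ K ⊆ P submodule : K ≅ Q and P/K ≅ L' }|. (This is the counting identity |_Q Hom_A(P,M)_B| = Σ_{[L]} a_L F^P_{LQ} F^M_{BL} of equation (2.8), written out with submodule counts.) -/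
open scoped Classical

section helper
variable {A M P : Type} [Ring A] [AddCommGroup M] [Module A M] [AddCommGroup P] [Module A P]

def mkMap (L : Submodule A M) (K : Submodule A P) (e : (P ⧸ K) ≃ₗ[A] L) : P →ₗ[A] M :=
  L.subtype ∘ₗ e.toLinearMap ∘ₗ K.mkQ

theorem mkMap_apply (L : Submodule A M) (K : Submodule A P) (e : (P ⧸ K) ≃ₗ[A] L) (x : P) :
    mkMap L K e x = (e (K.mkQ x) : M) := rfl

theorem ker_mkMap (L : Submodule A M) (K : Submodule A P) (e : (P ⧸ K) ≃ₗ[A] L) :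
    LinearMap.ker (mkMap L K e) = K := by
  ext x
  rw [LinearMap.mem_ker, mkMap_apply]
  simp

theorem range_mkMap (L : Submodule A M) (K : Submodule A P) (e : (P ⧸ K) ≃ₗ[A] L) :
    LinearMap.range (mkMap L K e) = L := by
  ext y
  rw [LinearMap.mem_range]
  constructor
  · rintro ⟨x, rfl⟩
    rw [mkMap_apply]
    exact Subtype.property _
  · intro hy
    obtain ⟨x, hx⟩ := K.mkQ_surjective (e.symm ⟨y, hy⟩)
    exact ⟨x, by rw [mkMap_apply, hx, e.apply_symm_apply]⟩

variable (A M P) in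
theorem card_aux (p : Submodule A M → Prop) (q : Submodule A P → Prop) :
    Nat.card {f : P →ₗ[A] M // q (LinearMap.ker f) ∧ p (LinearMap.range f)} =
    Nat.card (Σ L : {L : Submodule A M // p L},
      Σ K : {K : Submodule A P // q K ∧ Nonempty ((P ⧸ K) ≃ₗ[A] L.1)},
        ((P ⧸ K.1) ≃ₗ[A] L.1)) := by
  symm
  refine Nat.card_congr (Equiv.ofBijective
    (fun t => ⟨mkMap t.1.1 t.2.1.1 t.2.2, ?_, ?_⟩) ⟨?_, ?_⟩)
  · rw [ker_mkMap]; exact t.2.1.2.1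
  · rw [range_mkMap]; exact t.1.2
  · rintro ⟨⟨L, hL⟩, ⟨K, hK⟩, e⟩ ⟨⟨L2, hL2⟩, ⟨K2, hK2⟩, e2⟩ h
    have h : mkMap L K e = mkMap L2 K2 e2 := congrArg Subtype.val h
    obtain rfl : L = L2 := by rw [← range_mkMap L K e, h, range_mkMap]
    obtain rfl : K = K2 := by rw [← ker_mkMap L K e, h, ker_mkMap]
    obtain rfl : e = e2 := by
      ext x
      obtain ⟨x, rfl⟩ := K.mkQ_surjective x
      exact LinearMap.congr_fun h x
    rfl
  · rintro ⟨f, hq, hp⟩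
    refine ⟨⟨⟨LinearMap.range f, hp⟩, ⟨LinearMap.ker f, hq, ⟨f.quotKerEquivRange⟩⟩,
      f.quotKerEquivRange⟩, ?_⟩
    apply Subtype.ext
    ext x
    rfl

end helper

/-- Equation (2.8): the counting identity `|_Q Hom_A(P,M)_B| = Σ_{[L]} a_L F^P_{LQ} F^M_{BL}`,
written out with submodule counts: the number of `A`-linear maps `f : P → M` with
`ker f ≅ Q` and `coker f ≅ B` equals the sum over all submodules `L' ⊆ M` with
`M/L' ≅ B` of `|Aut_A(L')|` times the number of submodules `K ⊆ P` with `K ≅ Q` and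
`P/K ≅ L'`. -/
theorem stmt_15 (k : Type) [Field k] [Fintype k] (A : Type) [Ring A] [Algebra k A]
    [FiniteDimensional k A]
    (B M P Q : Type) [AddCommGroup B] [Module A B] [AddCommGroup M] [Module A M]
    [AddCommGroup P] [Module A P] [AddCommGroup Q] [Module A Q]
    [Module.Finite A B] [Module.Finite A M] [Module.Finite A P] [Module.Finite A Q] :
    Nat.card {f : P →ₗ[A] M //
        Nonempty ((LinearMap.ker f) ≃ₗ[A] Q) ∧
          Nonempty ((M ⧸ LinearMap.range f) ≃ₗ[A] B)}
      = ∑ᶠ L' : Submodule A M,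
          if Nonempty ((M ⧸ L') ≃ₗ[A] B) then
            Nat.card (L' ≃ₗ[A] L') *
              Nat.card {K : Submodule A P //
                Nonempty (K ≃ₗ[A] Q) ∧ Nonempty ((P ⧸ K) ≃ₗ[A] L')}
          else 0 := by
  have : Finite A := Module.finite_of_finite k
  have : Finite M := Module.finite_of_finite A
  have : Finite P := Module.finite_of_finite A
  have : Finite (Submodule A M) := Finite.of_injective _ SetLike.coe_injective
  have : Finite (Submodule A P) := Finite.of_injective _ SetLike.coe_injective
  have hfin : ∀ (L : Submodule A M) (K : Submodule A P), Finite ((P ⧸ K) ≃ₗ[A] L) := by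
    intro L K
    have : Finite (P ⧸ K) := Finite.of_surjective _ K.mkQ_surjective
    exact DFunLike.finite _
  have := Fintype.ofFinite (Submodule A M)
  have := Fintype.ofFinite {L : Submodule A M // Nonempty ((M ⧸ L) ≃ₗ[A] B)}
  rw [card_aux A M P (fun L => Nonempty ((M ⧸ L) ≃ₗ[A] B)) (fun K => Nonempty (K ≃ₗ[A] Q)),
    finsum_eq_sum_of_fintype, Nat.card_sigma, ← Finset.sum_filter,
    Finset.sum_subtype (p := fun L : Submodule A M => Nonempty ((M ⧸ L) ≃ₗ[A] B)) _ (by simp)]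
  refine Finset.sum_congr (by ext; simp) fun L _ => ?_
  have := Fintype.ofFinite {K : Submodule A P //
    Nonempty (K ≃ₗ[A] Q) ∧ Nonempty ((P ⧸ K) ≃ₗ[A] L.1)}
  rw [Nat.card_sigma, Finset.sum_congr rfl (g := fun _ => Nat.card (L.1 ≃ₗ[A] L.1))]
  · rw [Finset.sum_const, Finset.card_univ, smul_eq_mul, mul_comm, ← Nat.card_eq_fintype_card]
  · rintro ⟨K, hK, ⟨e⟩⟩ _
    exact Nat.card_congr
      ⟨fun g => e.symm.trans g, fun g => e.trans g, fun g => by ext; simp, fun g => by ext; simp⟩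
  infer_instance
end
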